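/- arXiv:2405.11946 — 2 statements merged into one kernel-verified Lean document; each statement's English description precedes it below -/
import Mathlib

section
/- Let n ≥ 3 and k ≥ 2. If n(k+1) is even, the coefficient of e_{(n(k+1)/2 + 1, n(k+1)/2 − 1)} in the expansion of X_{S(n;k)} in the elementary symmetric function basis equals n(k+1)(1−n). If n(k+1) is odd, the coefficient of e_{((n(k+1)+1)/2, (n(k+1)−1)/2)} in X_{S(n;k)} equals n(k+1)(1−n). -/
noncomputable section

open SimpleGraph

/-- The chromatic symmetric function of a finite simple graph, as a formal power
series in countably many commuting variables `x_0, x_1, x_2, …`: the coefficient of the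
monomial `∏ i, x_i ^ d i` is the number of proper colourings `κ : V → ℕ` in which colour `i`
is used exactly `d i` times. -/
def csf {V : Type} [Fintype V] (G : SimpleGraph V) : MvPowerSeries ℕ ℚ :=
  fun d => (Nat.card {κ : V → ℕ //
      (∀ u v : V, G.Adj u v → κ u ≠ κ v) ∧
      ∀ i : ℕ, Nat.card {v : V // κ v = i} = d i} : ℚ)

/-- The elementary symmetric function `e_k` as a formal power series. -/
def esym (k : ℕ) : MvPowerSeries ℕ ℚ :=
  fun d => if (∀ i ∈ d.support, d i = 1) ∧ (d.sum fun _ v => v) = k then 1 else 0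

/-- `e_λ` for a partition `λ` given as a multiset of parts. -/
def esymM (μ : Multiset ℕ) : MvPowerSeries ℕ ℚ :=
  (μ.map esym).prod

/-- A symmetric function is `e`-positive if it is a finite nonnegative linear combination
of the elementary symmetric functions `e_λ`, `λ` a partition (all parts positive). -/
def EPositive (f : MvPowerSeries ℕ ℚ) : Prop :=
  ∃ c : Multiset ℕ →₀ ℚ, (∀ μ, 0 ≤ c μ) ∧ (∀ μ ∈ c.support, 0 ∉ μ) ∧
    f = c.sum fun μ a => a • esymM μ

/-- The path `P_k` on `k` vertices. -/
def pathG (k : ℕ) : SimpleGraph (Fin k) :=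
  SimpleGraph.fromRel (fun i j => (j : ℕ) = (i : ℕ) + 1)

/-- The cycle `C_m` on `m` vertices (for `m = 2` this is a single edge, i.e. `P_2`). -/
def cycleG (m : ℕ) : SimpleGraph (Fin m) :=
  SimpleGraph.fromRel (fun i j => (j : ℕ) = ((i : ℕ) + 1) % m)

/-- Auxiliary relation for sun graphs: body relation on `Fin n`, plus rays
`P_{lam i}` attached at vertex `i`, the leaf `⟨i,0⟩` of ray `i` being joined to `i`. -/
def sunRel (n : ℕ) (lam : Fin n → ℕ) (body : Fin n → Fin n → Prop) :
    (Fin n ⊕ ((i : Fin n) × Fin (lam i))) → (Fin n ⊕ ((i : Fin n) × Fin (lam i))) → Prop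
  | Sum.inl i, Sum.inl i' => body i i'
  | Sum.inl i, Sum.inr p => p.1 = i ∧ (p.2 : ℕ) = 0
  | Sum.inr p, Sum.inr q => p.1 = q.1 ∧ (q.2 : ℕ) = (p.2 : ℕ) + 1
  | _, _ => False

/-- The sun graph `S(n; λ_1, …, λ_n)`: a cycle `C_n` with a path `P_{λ_i}` (a *ray*)
joined by an edge to the `i`-th cycle vertex, for each `i`. -/
def sunGraph (n : ℕ) (lam : Fin n → ℕ) :
    SimpleGraph (Fin n ⊕ ((i : Fin n) × Fin (lam i))) :=
  SimpleGraph.fromRel (sunRel n lam (fun i i' => (i' : ℕ) = ((i : ℕ) + 1) % n))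

/-- The complete sun graph `S̄(n; λ_1, …, λ_n)`: as `sunGraph`, but with complete body `K_n`. -/
def completeSunGraph (n : ℕ) (lam : Fin n → ℕ) :
    SimpleGraph (Fin n ⊕ ((i : Fin n) × Fin (lam i))) :=
  SimpleGraph.fromRel (sunRel n lam (fun i i' => i ≠ i'))

/-- The spider `S(μ_1, …, μ_d)`: `d` paths (legs) `P_{μ_i}`, each joined at a leaf to a
common centre vertex. -/
def spiderGraph (d : ℕ) (mu : Fin d → ℕ) :
    SimpleGraph (Unit ⊕ ((i : Fin d) × Fin (mu i))) :=
  SimpleGraph.fromRel (fun a b => match a, b with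
    | Sum.inl _, Sum.inr p => (p.2 : ℕ) = 0
    | Sum.inr p, Sum.inr q => p.1 = q.1 ∧ (q.2 : ℕ) = (p.2 : ℕ) + 1
    | _, _ => False)

/-- The graph obtained from a body graph `H` on `Fin n` by joining each body vertex `i`
by an edge to a chosen vertex `u i` of a graph `Gs i`. -/
def attachGraph {n : ℕ} {Vs : Fin n → Type} (H : SimpleGraph (Fin n))
    (Gs : ∀ i, SimpleGraph (Vs i)) (u : ∀ i, Vs i) :
    SimpleGraph (Fin n ⊕ ((i : Fin n) × Vs i)) :=
  SimpleGraph.fromRel (fun a b => match a, b with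
    | Sum.inl i, Sum.inl i' => H.Adj i i'
    | Sum.inl i, Sum.inr p => p.1 = i ∧ p.2 = u p.1
    | Sum.inr p, Sum.inr q => ∃ h : p.1 = q.1, (Gs q.1).Adj (h ▸ p.2) q.2
    | _, _ => False)

/-- `G` has a connected partition of type `μ`: a partition of the vertex set all of whose
blocks induce connected subgraphs, the multiset of block sizes being `μ`. -/
def HasConnectedPartition {V : Type} [Fintype V] [DecidableEq V]
    (G : SimpleGraph V) (μ : Multiset ℕ) : Prop :=
  ∃ P : Finpartition (Finset.univ : Finset V),
    (∀ p ∈ P.parts, (G.induce (↑p : Set V)).Connected) ∧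
      P.parts.val.map Finset.card = μ

/-- `G` has a perfect matching: a partition of `V(G)` into pairs of adjacent vertices. -/
def HasPerfectMatching {V : Type} (G : SimpleGraph V) : Prop :=
  ∃ M : G.Subgraph, M.IsPerfectMatching

/-- `G` has an almost perfect matching: a partition of `V(G)` into pairs of adjacent
vertices together with one singleton. -/
def HasAlmostPerfectMatching {V : Type} (G : SimpleGraph V) : Prop :=
  ∃ M : G.Subgraph, M.IsMatching ∧ ∃ v : V, M.verts = {v}ᶜ

/-- The tadpole graph `T_{m,l}`: the cycle `C_m` (vertices `0, …, m-1`, consecutive edges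
plus the chord `{0, m-1}`) with a path on `l` further vertices attached by an edge at
vertex `m-1`.  For `l = 0` this is just `C_m`. -/
def tadpole (m l : ℕ) : SimpleGraph (Fin (m + l)) :=
  SimpleGraph.fromRel (fun i j =>
    (j : ℕ) = (i : ℕ) + 1 ∨ ((i : ℕ) = 0 ∧ (j : ℕ) = m - 1))

/-- Dumbbell with path-parameter `t = l + 1 ≥ 0`: vertices `0, …, m-1` form the cycle `C_m`
(consecutive edges plus chord `{0, m-1}`), vertices `m+t-1, …, m+n+t-2` form the cycle `C_n`
(consecutive edges plus chord `{m+t-1, m+n+t-2}`), and the vertices in between form the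
connecting path; for `t = 0` (i.e. `l = -1`) the two cycles share the vertex `m-1`. -/
def dumbbellAux (m n t : ℕ) : SimpleGraph (Fin (m + n + t - 1)) :=
  SimpleGraph.fromRel (fun i j =>
    (j : ℕ) = (i : ℕ) + 1
      ∨ ((i : ℕ) = 0 ∧ (j : ℕ) = m - 1)
      ∨ ((i : ℕ) = m + t - 1 ∧ (j : ℕ) = m + n + t - 2))

/-- The dumbbell graph `D(m, l, n)` for `l ≥ -1`: cycles `C_m` and `C_n` joined by a path
on `l` vertices (for `l = 1` a single joining vertex, for `l = 0` a joining edge, and for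
`l = -1` the two cycles share a vertex). -/
def dumbbell (m n : ℕ) (l : ℤ) : SimpleGraph (Fin (m + n + (l + 1).toNat - 1)) :=
  dumbbellAux m n (l + 1).toNat

end

open Classical in
/-- The chromatic polynomial of `G` in the variables indexed by a finite set `C` of colours:
the sum of `∏ v, X (κ v)` over the proper colourings `κ : V → C`. -/
noncomputable def properPoly {V C : Type} [Fintype V] [Fintype C] (G : SimpleGraph V) : MvPolynomial C ℚ :=
  ∑ κ : V → C with (∀ u v : V, G.Adj u v → κ u ≠ κ v), ∏ v, MvPolynomial.X (κ v)

lemma sum_single_apply_eq_card {V C : Type} [Fintype V] (κ : V → C) (i : C) :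
    (∑ v, Finsupp.single (κ v) 1 : C →₀ ℕ) i = Nat.card {v : V // κ v = i} := by
  classical
  simp [Finsupp.finsetSum_apply, Finsupp.single_apply, Fintype.card_subtype]

lemma killCompl_csf {V : Type} [Fintype V] (G : SimpleGraph V) (M : ℕ) :
    MvPowerSeries.killCompl (R := ℚ) (Fin.valEmbedding (n := M)) (csf G) =
      (properPoly G : MvPolynomial (Fin M) ℚ) := by
  classical
  ext d
  rw [MvPowerSeries.coeff_killCompl, MvPolynomial.coeff_coe, properPoly, MvPolynomial.coeff_sum]
  have hX (κ : V → Fin M) : (∏ v, MvPolynomial.X (R := ℚ) (κ v)) =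
      MvPolynomial.monomial (∑ v, Finsupp.single (κ v) 1) 1 := by
    rw [MvPolynomial.monomial_sum_one]; rfl
  simp only [hX, MvPolynomial.coeff_monomial]
  rw [Finset.sum_boole, Finset.filter_filter, ← Fintype.card_subtype, ← Nat.card_eq_fintype_card]
  change ((Nat.card _ : ℕ) : ℚ) = _
  congr 1
  refine (Nat.card_congr (Equiv.ofBijective (fun κ => ⟨fun v => (κ.1 v : ℕ), ?adj, ?cnt⟩)
    ⟨?inj, ?surj⟩)).symm
  case adj =>
    intro u v huv h
    exact κ.2.1 u v huv (Fin.ext h)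
  case cnt =>
    intro i
    by_cases hi : i < M
    · rw [show i = Fin.valEmbedding (⟨i, hi⟩ : Fin M) from rfl, Finsupp.embDomain_apply_self]
      refine Eq.trans ?_ (DFunLike.congr_fun κ.2.2 ⟨i, hi⟩)
      rw [sum_single_apply_eq_card]
      simp [Fin.ext_iff]
    · rw [Finsupp.embDomain_of_notMem_range _ _ _ (by rintro ⟨j, rfl⟩; exact hi j.2)]
      have : IsEmpty {v : V // (κ.1 v : ℕ) = i} := ⟨fun v => hi (v.2 ▸ (κ.1 v.1).2)⟩
      simp
  case inj =>
    intro κ κ' h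
    ext v
    exact congrFun (congrArg Subtype.val h) v
  case surj =>
    rintro ⟨κ, hκ, hd⟩
    have hlt : ∀ v, κ v < M := by
      intro v
      by_contra hv
      have h := hd (κ v)
      rw [Finsupp.embDomain_of_notMem_range _ _ _ (by rintro ⟨j, hj⟩; exact hv (hj ▸ j.2))] at h
      have : Nonempty {w : V // κ w = κ v} := ⟨⟨v, rfl⟩⟩
      exact Nat.card_pos.ne' h
    refine ⟨⟨fun v => ⟨κ v, hlt v⟩, ?_, ?_⟩, rfl⟩
    · intro u v huv h
      exact hκ u v huv (congrArg Fin.val h)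
    · ext i
      rw [sum_single_apply_eq_card, ← Finsupp.embDomain_apply_self Fin.valEmbedding d i, ← hd]
      simp [Fin.ext_iff]

lemma killCompl_esym (M k : ℕ) :
    MvPowerSeries.killCompl (R := ℚ) (Fin.valEmbedding (n := M)) (esym k) =
      (MvPolynomial.esymm (Fin M) ℚ k : MvPolynomial (Fin M) ℚ) := by
  classical
  ext d
  rw [MvPowerSeries.coeff_killCompl, MvPolynomial.coeff_coe, MvPolynomial.esymm_eq_sum_monomial,
    MvPolynomial.coeff_sum]
  simp only [MvPolynomial.coeff_monomial]
  change (if _ then (1 : ℚ) else 0) = _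
  have hval (t : Finset (Fin M)) (i : Fin M) :
      (∑ j ∈ t, Finsupp.single j 1 : Fin M →₀ ℕ) i = if i ∈ t then 1 else 0 := by
    simp [Finsupp.finsetSum_apply, Finsupp.single_apply]
  have hsupp {t : Finset (Fin M)} (ht : (∑ j ∈ t, Finsupp.single j 1 : Fin M →₀ ℕ) = d) :
      t = d.support := by
    ext i
    rw [← ht, Finsupp.mem_support_iff, hval]
    simp
  have hdeg : ((Finsupp.embDomain Fin.valEmbedding d).sum fun _ v => v) = d.sum fun _ v => v := by
    rw [Finsupp.sum_embDomain]
  rw [hdeg]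
  simp only [Finsupp.support_embDomain, Finset.mem_map, forall_exists_index, and_imp,
    forall_apply_eq_imp_iff₂, Finsupp.embDomain_apply_self]
  split_ifs with h
  · have hd : (∑ j ∈ d.support, Finsupp.single j 1 : Fin M →₀ ℕ) = d := by
      ext i
      rw [hval]
      split_ifs with hi
      · exact (h.1 i hi).symm
      · simpa using (Finsupp.notMem_support_iff.mp hi).symm
    rw [Finset.sum_eq_single d.support, if_pos hd]
    · exact fun t _ ht => if_neg fun h' => ht (hsupp h')
    · intro hn
      refine absurd (Finset.mem_powersetCard.mpr ⟨Finset.subset_univ _, ?_⟩) hn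
      rw [← h.2, Finsupp.sum, Finset.sum_congr rfl h.1]
      simp
  · symm
    refine Finset.sum_eq_zero fun t ht => if_neg fun h' => h ?_
    have hs := hsupp h'
    have h1 : ∀ i ∈ d.support, d i = 1 := by
      intro i hi
      rw [← h', hval, if_pos (hs ▸ hi)]
    refine ⟨h1, ?_⟩
    rw [Finsupp.sum, Finset.sum_congr rfl h1, ← (Finset.mem_powersetCard.mp ht).2, hs]
    simp

lemma killCompl_esymM (M : ℕ) (μ : Multiset ℕ) :
    MvPowerSeries.killCompl (R := ℚ) (Fin.valEmbedding (n := M)) (esymM μ) =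
      ((μ.map (MvPolynomial.esymm (Fin M) ℚ)).prod : MvPolynomial (Fin M) ℚ) := by
  rw [esymM, map_multiset_prod, Multiset.map_map, ← MvPolynomial.coeToMvPowerSeries.ringHom_apply,
    map_multiset_prod, Multiset.map_map]
  simp [Function.comp_def, killCompl_esym]

lemma isHomogeneous_esymm (M k : ℕ) : (MvPolynomial.esymm (Fin M) ℚ k).IsHomogeneous k := by
  refine MvPolynomial.IsHomogeneous.sum _ _ _ fun t ht => ?_
  have := MvPolynomial.IsHomogeneous.prod t (fun i => (MvPolynomial.X i : MvPolynomial (Fin M) ℚ)) (fun _ => 1)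
    fun i _ => MvPolynomial.isHomogeneous_X ℚ i
  simpa [(Finset.mem_powersetCard.mp ht).2] using this

lemma isHomogeneous_prod_esymm (M : ℕ) (μ : Multiset ℕ) :
    (μ.map (MvPolynomial.esymm (Fin M) ℚ)).prod.IsHomogeneous μ.sum := by
  induction μ using Multiset.induction_on with
  | empty => simpa using MvPolynomial.isHomogeneous_one _ _
  | cons a μ ih => simpa using (isHomogeneous_esymm M a).mul ih

lemma isHomogeneous_properPoly {V : Type} [Fintype V] (G : SimpleGraph V) (M : ℕ) :
    (properPoly G : MvPolynomial (Fin M) ℚ).IsHomogeneous (Fintype.card V) := by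
  refine MvPolynomial.IsHomogeneous.sum _ _ _ fun κ _ => ?_
  simpa using MvPolynomial.IsHomogeneous.prod Finset.univ
    (fun v => MvPolynomial.X (R := ℚ) (κ v)) (fun _ => 1)
    fun v _ => MvPolynomial.isHomogeneous_X ℚ _

/-- In finitely many variables, only the partitions of `|V|` contribute to an expansion of the
chromatic symmetric function in elementary symmetric functions. -/
lemma properPoly_eq_sum {V : Type} [Fintype V] (G : SimpleGraph V) (M : ℕ)
    (c : Multiset ℕ →₀ ℚ) (hc : csf G = c.sum fun μ a => a • esymM μ) :
    (properPoly G : MvPolynomial (Fin M) ℚ) =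
      ∑ μ ∈ c.support with μ.sum = Fintype.card V,
        c μ • (μ.map (MvPolynomial.esymm (Fin M) ℚ)).prod := by
  have h := congrArg (MvPowerSeries.killCompl (R := ℚ) (Fin.valEmbedding (n := M))) hc
  rw [killCompl_csf, Finsupp.sum, map_sum] at h
  simp only [map_smul, killCompl_esymM] at h
  have h' : (properPoly G : MvPolynomial (Fin M) ℚ) =
      ∑ μ ∈ c.support, c μ • (μ.map (MvPolynomial.esymm (Fin M) ℚ)).prod := by
    apply MvPolynomial.coe_injective
    rw [h, ← MvPolynomial.coeToMvPowerSeries.ringHom_apply, map_sum]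
    simp
  have h'' := congrArg (MvPolynomial.homogeneousComponent (Fintype.card V)) h'
  rw [MvPolynomial.homogeneousComponent_of_mem (isHomogeneous_properPoly G M), if_pos rfl,
    map_sum] at h''
  rw [h'', Finset.sum_filter]
  refine Finset.sum_congr rfl fun μ _ => ?_
  rw [map_smul, MvPolynomial.homogeneousComponent_of_mem (isHomogeneous_prod_esymm M μ)]
  simp only [eq_comm, smul_ite, smul_zero]

/-- For `0 < b < a` there are complex numbers `x_1, …, x_a` whose elementary symmetric functions
`e_a`, `e_b` and `e_0` equal `1`, all others being `0`. -/
lemma exists_esymm_eq (a b : ℕ) (hb : 0 < b) (hba : b < a) :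
    ∃ x : Fin a → ℂ, ∀ m, MvPolynomial.aeval x (MvPolynomial.esymm (Fin a) ℚ m) =
      if m = 0 ∨ m = b ∨ m = a then 1 else 0 := by
  classical
  let P : Polynomial ℂ := Polynomial.X ^ a + (Polynomial.C ((-1) ^ b) * Polynomial.X ^ (a - b) +
    Polynomial.C ((-1) ^ a))
  have hdeg : (Polynomial.C ((-1) ^ b) * Polynomial.X ^ (a - b) +
    Polynomial.C ((-1) ^ a) : Polynomial ℂ).degree < a := by
    refine (Polynomial.degree_add_le _ _).trans_lt (max_lt ?_ ?_)
    · refine (Polynomial.degree_C_mul_X_pow_le _ _).trans_lt ?_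
      exact_mod_cast (by omega : a - b < a)
    · refine Polynomial.degree_C_le.trans_lt ?_
      exact_mod_cast (by omega : 0 < a)
  have hmonic : P.Monic := Polynomial.monic_X_pow_add hdeg
  have hnat : P.natDegree = a := by
    rw [Polynomial.natDegree_add_eq_left_of_degree_lt (by rwa [Polynomial.degree_X_pow]),
      Polynomial.natDegree_X_pow]
  have hcard : P.roots.card = a :=
    hnat ▸ (Polynomial.splits_iff_card_roots.mp (IsAlgClosed.splits P))
  obtain ⟨l, hl⟩ := Quot.exists_rep P.roots
  have hlen : l.length = a := by rw [← hcard, ← hl]; rfl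
  subst hlen
  refine ⟨l.get, fun m => ?_⟩
  have hroots : Finset.univ.val.map l.get = P.roots := by
    rw [← hl]
    simp [Fin.univ_val_map]
  rw [MvPolynomial.aeval_esymm_eq_multiset_esymm, hroots]
  rcases lt_or_ge l.length m with hm | hm
  · rw [if_neg (by omega), Multiset.esymm, Multiset.powersetCard_eq_empty _ (by omega)]
    simp
  · have h := Polynomial.coeff_eq_esymm_roots_of_card (p := P) (hcard.trans hnat.symm)
      (k := l.length - m) (by omega)
    rw [hmonic.leadingCoeff, one_mul, hnat, show l.length - (l.length - m) = m by omega] at h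
    have hc : P.coeff (l.length - m) = (-1) ^ m * if m = 0 ∨ m = b ∨ m = l.length then 1 else 0 := by
      simp only [P, Polynomial.coeff_add, Polynomial.coeff_X_pow, Polynomial.coeff_C_mul,
        Polynomial.coeff_C]
      rcases eq_or_ne m 0 with rfl | h0
      · rw [if_pos (by omega), if_neg (by omega), if_neg (by omega)]; simp
      rcases eq_or_ne m b with rfl | hb'
      · rw [if_neg (by omega), if_pos (by omega), if_neg (by omega)]; simp
      rcases eq_or_ne m l.length with rfl | hl'
      · rw [if_neg (by omega), if_neg (by omega), if_pos (by omega)]; simp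
      · rw [if_neg (by omega), if_neg (by omega), if_neg (by omega), if_neg (by omega)]; simp
    rw [hc] at h
    exact (mul_left_cancel₀ (pow_ne_zero m (by norm_num)) h).symm

/-- Newton's identities for points whose only nonzero elementary symmetric functions are
`e_0 = e_b = e_a = 1`. -/
lemma newton_of_esymm {a b : ℕ} (hb : 0 < b) (hba : b < a) {M : ℕ} {x : Fin M → ℂ}
    (hx : ∀ m, MvPolynomial.aeval x (MvPolynomial.esymm (Fin M) ℚ m) =
      if m = 0 ∨ m = b ∨ m = a then 1 else 0) {m : ℕ} (hm : 0 < m) :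
    (m : ℂ) * (if m = b ∨ m = a then 1 else 0) = (-1) ^ (m + 1) * (∑ c, x c ^ m +
      (if b < m then (-1) ^ b * ∑ c, x c ^ (m - b) else 0) +
      (if a < m then (-1) ^ a * ∑ c, x c ^ (m - a) else 0)) := by
  have h := congrArg (MvPolynomial.aeval x) (MvPolynomial.mul_esymm_eq_sum (Fin M) ℚ m)
  simp only [map_mul, map_natCast, map_sum, map_pow, map_neg, map_one, hx, MvPolynomial.psum,
    MvPolynomial.aeval_X] at h
  have hm0 : m ≠ 0 := hm.ne'
  simp only [hm0, false_or] at h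
  rw [h]
  congr 1
  rw [Finset.sum_filter, Finset.Nat.sum_antidiagonal_eq_sum_range_succ
    (fun i j => if i < m then (-1 : ℂ) ^ i * (if i = 0 ∨ i = b ∨ i = a then 1 else 0) *
      ∑ c, x c ^ j else 0)]
  have hsplit (i : ℕ) : (if i < m then (-1 : ℂ) ^ i * (if i = 0 ∨ i = b ∨ i = a then 1 else 0) *
      ∑ c, x c ^ (m - i) else 0) =
      (if i = 0 then ∑ c, x c ^ m else 0) +
      (if i = b then (if b < m then (-1) ^ b * ∑ c, x c ^ (m - b) else 0) else 0) +
      (if i = a then (if a < m then (-1) ^ a * ∑ c, x c ^ (m - a) else 0) else 0) := by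
    rcases eq_or_ne i 0 with rfl | h0
    · simp [hm, hb.ne, (hb.trans hba).ne]
    rcases eq_or_ne i b with rfl | h1
    · simp [h0, hba.ne]
    rcases eq_or_ne i a with rfl | h2
    · simp [h0, h1]
    · simp [h0, h1, h2]
  simp only [hsplit, Finset.sum_add_distrib, Finset.sum_ite_eq', Finset.mem_range]
  refine congrArg₂ (· + ·) (congrArg₂ (· + ·) ?_ ?_) ?_
  · simp
  · split_ifs <;> first | rfl | (exfalso; omega)
  · split_ifs <;> first | rfl | (exfalso; omega)

lemma sum_pow_eq_zero_of_esymm {a b : ℕ} (hba : b < a) (hab : a < 2 * b) {M : ℕ} {x : Fin M → ℂ}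
    (hx : ∀ m, MvPolynomial.aeval x (MvPolynomial.esymm (Fin M) ℚ m) =
      if m = 0 ∨ m = b ∨ m = a then 1 else 0) {m : ℕ} (hm : 0 < m) (hmN : m < a + b)
    (h1 : m ≠ b) (h2 : m ≠ a) (h3 : m ≠ 2 * b) : ∑ c, x c ^ m = 0 := by
  induction m using Nat.strong_induction_on with
  | _ m ih =>
    have h := newton_of_esymm (by omega) hba hx hm
    rw [if_neg (by omega), mul_zero, eq_comm, mul_eq_zero, or_iff_right (by simp)] at h
    have e1 : (if b < m then (-1) ^ b * ∑ c, x c ^ (m - b) else (0 : ℂ)) = 0 := by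
      split_ifs
      · rw [ih (m - b) (by omega) (by omega) (by omega) (by omega) (by omega) (by omega), mul_zero]
      · rfl
    have e2 : (if a < m then (-1) ^ a * ∑ c, x c ^ (m - a) else (0 : ℂ)) = 0 := by
      split_ifs
      · rw [ih (m - a) (by omega) (by omega) (by omega) (by omega) (by omega) (by omega), mul_zero]
      · rfl
    simpa [e1, e2] using h

lemma sum_pow_add_of_esymm {a b : ℕ} (hba : b < a) (hab : a < 2 * b) {M : ℕ} {x : Fin M → ℂ}
    (hx : ∀ m, MvPolynomial.aeval x (MvPolynomial.esymm (Fin M) ℚ m) =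
      if m = 0 ∨ m = b ∨ m = a then 1 else 0) :
    ∑ c, x c ^ (a + b) = (-1) ^ (a + b) * (a + b) := by
  have hN := newton_of_esymm (by omega) hba hx (m := a + b) (by omega)
  have hA := newton_of_esymm (by omega) hba hx (m := a) (by omega)
  have hB := newton_of_esymm (by omega) hba hx (m := b) (by omega)
  have h0 : ∑ c, x c ^ (a - b) = 0 :=
    sum_pow_eq_zero_of_esymm hba hab hx (by omega) (by omega) (by omega) (by omega) (by omega)
  rw [if_neg (by omega), if_pos (by omega), if_pos (by omega), mul_zero, Nat.add_sub_cancel,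
    Nat.add_sub_cancel_left, eq_comm, mul_eq_zero, or_iff_right (by simp)] at hN
  rw [if_pos (by omega), if_pos (by omega), if_neg (by omega), h0] at hA
  rw [if_pos (by omega), if_neg (by omega), if_neg (by omega)] at hB
  have sa : ((-1 : ℂ) ^ a) ^ 2 = 1 := by rw [← pow_mul, mul_comm, pow_mul]; simp
  have sb : ((-1 : ℂ) ^ b) ^ 2 = 1 := by rw [← pow_mul, mul_comm, pow_mul]; simp
  simp only [pow_add, pow_one] at *
  linear_combination hN - (-1 : ℂ) ^ b * (-1) ^ a * hA - (-1 : ℂ) ^ b * (-1) ^ a * hB +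
    (-1 : ℂ) ^ b * (∑ c, x c ^ a) * sa + (-1 : ℂ) ^ a * (∑ c, x c ^ b) * sb

open Classical in
/-- If the power sums `p_1, …, p_k` vanish at `x`, the weighted number of proper colourings of a
path on `k` vertices hanging from a vertex of colour `c` is `(-1)^k x_c^k`. -/
lemma sum_ray_colorings {C R : Type} [Fintype C] [CommRing R] (x : C → R) (k : ℕ)
    (hx : ∀ m, 0 < m → m ≤ k → ∑ c, x c ^ m = 0) (c : C) :
    (∑ ρ : Fin k → C, if (∀ j : Fin k, (j : ℕ) = 0 → c ≠ ρ j) ∧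
      (∀ j j' : Fin k, (j' : ℕ) = j + 1 → ρ j ≠ ρ j') then ∏ j, x (ρ j) else 0) =
      (-1) ^ k * x c ^ k := by
  induction k generalizing c with
  | zero => simp
  | succ k ih =>
    rw [← (Fin.consEquiv fun _ => C).sum_comp, Fintype.sum_prod_type]
    have hcond (c' : C) (ρ : Fin k → C) :
        ((∀ j : Fin (k + 1), (j : ℕ) = 0 → c ≠ Fin.cons (α := fun _ => C) c' ρ j) ∧
          ∀ j j' : Fin (k + 1), (j' : ℕ) = j + 1 →
            Fin.cons (α := fun _ => C) c' ρ j ≠ Fin.cons (α := fun _ => C) c' ρ j') ↔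
        c ≠ c' ∧ ((∀ j : Fin k, (j : ℕ) = 0 → c' ≠ ρ j) ∧
          ∀ j j' : Fin k, (j' : ℕ) = j + 1 → ρ j ≠ ρ j') := by
      simp [Fin.forall_fin_succ, -ne_eq]
    have hstep (c' : C) : (∑ ρ : Fin k → C, if c ≠ c' ∧ ((∀ j : Fin k, (j : ℕ) = 0 → c' ≠ ρ j) ∧
          ∀ j j' : Fin k, (j' : ℕ) = j + 1 → ρ j ≠ ρ j') then x c' * ∏ j, x (ρ j) else 0) =
        (-1) ^ k * x c' ^ (k + 1) - if c = c' then (-1) ^ k * x c' ^ (k + 1) else 0 := by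
      by_cases h : c = c'
      · simp [h]
      · have := ih (fun m h0 hm => hx m h0 (by omega)) c'
        simp only [ne_eq, h, not_false_eq_true, true_and, if_false, sub_zero]
        rw [pow_succ, ← mul_assoc, ← this, mul_comm, Finset.mul_sum]
        exact Finset.sum_congr rfl fun ρ _ => by rw [mul_ite, mul_zero]
    simp only [Fin.consEquiv_apply, hcond, Fin.prod_univ_succ, Fin.cons_zero, Fin.cons_succ, hstep]
    rw [Finset.sum_sub_distrib, ← Finset.mul_sum, hx (k + 1) (by omega) le_rfl]
    simp
    ring

open Classical in
/-- If the power sums `q_1, …, q_m` vanish at `y`, the weighted sum over proper colourings of a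
path on `m + 1` vertices, with a further weight `g` depending on the end colours. -/
lemma sum_path_colorings {C R : Type} [Fintype C] [CommRing R] (y : C → R) (m : ℕ)
    (hy : ∀ i, 0 < i → i ≤ m → ∑ c, y c ^ i = 0) (g : C → C → R) :
    (∑ κ : Fin (m + 1) → C, if (∀ i j : Fin (m + 1), (j : ℕ) = i + 1 → κ i ≠ κ j) then
      (∏ i, y (κ i)) * g (κ 0) (κ (Fin.last m)) else 0) =
      (-1) ^ m * ∑ a, y a ^ (m + 1) * g a a +
      (-1) ^ (m + 1) * ∑ b, ∑ i ∈ Finset.range m, ∑ a, y a ^ (i + 1) * y b ^ (m - i) * g a b := by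
  induction m generalizing g with
  | zero =>
    rw [← (Equiv.funUnique (Fin 1) C).symm.sum_comp]
    simp
  | succ m ih =>
    rw [← (Fin.consEquiv fun _ => C).sum_comp, Fintype.sum_prod_type, Finset.sum_comm]
    have hcond (c : C) (κ : Fin (m + 1) → C) :
        (∀ i j : Fin (m + 2), (j : ℕ) = i + 1 →
            Fin.cons (α := fun _ => C) c κ i ≠ Fin.cons (α := fun _ => C) c κ j) ↔
        c ≠ κ 0 ∧ ∀ i j : Fin (m + 1), (j : ℕ) = i + 1 → κ i ≠ κ j := by
      rw [Fin.forall_fin_succ]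
      refine and_congr ?_ ?_
      · rw [Fin.forall_fin_succ]
        simp [-ne_eq]
      · refine forall_congr' fun i => ?_
        rw [Fin.forall_fin_succ]
        simp [-ne_eq]
    have hstep (κ : Fin (m + 1) → C) : (∑ c : C, if c ≠ κ 0 ∧
          ∀ i j : Fin (m + 1), (j : ℕ) = i + 1 → κ i ≠ κ j then
          y c * (∏ i, y (κ i)) * g c (κ (Fin.last m)) else 0) =
        if (∀ i j : Fin (m + 1), (j : ℕ) = i + 1 → κ i ≠ κ j) then
          (∏ i, y (κ i)) * (∑ c, y c * g c (κ (Fin.last m)) - y (κ 0) * g (κ 0) (κ (Fin.last m)))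
        else 0 := by
      split_ifs with h
      · simp only [and_iff_left h]
        rw [← Finset.sum_filter, Finset.filter_ne', ← Finset.add_sum_erase _ _
          (Finset.mem_univ (κ 0)), add_sub_cancel_left, Finset.mul_sum]
        exact Finset.sum_congr rfl fun c _ => by ring
      · simp [h]
    simp only [Fin.consEquiv_apply, hcond, Fin.prod_univ_succ (n := m + 1), Fin.cons_zero,
      Fin.cons_succ, ← Fin.succ_last, hstep]
    rw [ih (fun i h0 hi => hy i h0 (by omega))
      (fun a b => ∑ c, y c * g c b - y a * g a b)]
    have hz (b : C) (i : ℕ) (hi : i ∈ Finset.range m) :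
        ∑ a, y a ^ (i + 1) * y b ^ (m - i) * (∑ c, y c * g c b - y a * g a b) =
          - ∑ a, y a ^ (i + 1 + 1) * y b ^ (m + 1 - (i + 1)) * g a b := by
      have h0 := hy (i + 1) (by omega) (by have := Finset.mem_range.mp hi; omega)
      simp only [mul_sub, Finset.sum_sub_distrib, ← Finset.sum_mul, h0, zero_mul, zero_sub]
      rw [Nat.add_sub_add_right]
      exact congrArg _ (Finset.sum_congr rfl fun a _ => by ring)
    rw [Finset.sum_congr rfl fun b _ => Finset.sum_congr rfl (hz b)]
    simp only [Finset.sum_range_succ' _ m, Finset.sum_neg_distrib, Finset.sum_add_distrib, mul_sub,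
      Finset.sum_sub_distrib]
    have e1 : ∑ b, ∑ a, y a ^ (0 + 1) * y b ^ (m + 1 - 0) * g a b =
        ∑ a, y a ^ (m + 1) * ∑ c, y c * g c a := by
      refine Finset.sum_congr rfl fun b _ => ?_
      rw [Finset.mul_sum]
      exact Finset.sum_congr rfl fun a _ => by simp; ring
    have e2 : ∑ a, y a ^ (m + 1) * (y a * g a a) = ∑ a, y a ^ (m + 1 + 1) * g a a :=
      Finset.sum_congr rfl fun a _ => by ring
    rw [e1, e2]
    ring

open Classical in
/-- If the power sums `q_1, …, q_{n-1}` vanish at `y`, the chromatic symmetric function of the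
cycle `C_n` takes the value `(-1)^n (1 - n) q_n` at `y`. -/
lemma sum_cycle_colorings {C R : Type} [Fintype C] [CommRing R] (y : C → R) (n : ℕ) (hn : 0 < n)
    (hy : ∀ i, 0 < i → i < n → ∑ c, y c ^ i = 0) :
    (∑ κ : Fin n → C, if (∀ i j : Fin n, (j : ℕ) = (i + 1) % n → κ i ≠ κ j) then
      ∏ i, y (κ i) else 0) = (-1) ^ n * (1 - n) * ∑ c, y c ^ n := by
  obtain ⟨m, rfl⟩ : ∃ m, n = m + 1 := ⟨n - 1, by omega⟩
  have hcond (κ : Fin (m + 1) → C) :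
      (∀ i j : Fin (m + 1), (j : ℕ) = (i + 1) % (m + 1) → κ i ≠ κ j) ↔
      (∀ i j : Fin (m + 1), (j : ℕ) = i + 1 → κ i ≠ κ j) ∧ κ 0 ≠ κ (Fin.last m) := by
    constructor
    · intro h
      refine ⟨fun i j hij => h i j ?_, (h (Fin.last m) 0 (by simp)).symm⟩
      rw [← hij, Nat.mod_eq_of_lt j.2]
    · rintro ⟨h1, h2⟩ i j hij
      rcases Nat.lt_or_ge (i + 1 : ℕ) (m + 1) with h | h
      · exact h1 i j (by rw [hij, Nat.mod_eq_of_lt h])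
      · have hi : i = Fin.last m := Fin.ext (by simp; omega)
        subst hi
        have hj : j = 0 := Fin.ext (by simpa using hij)
        subst hj
        exact h2.symm
  have h := sum_path_colorings y m (fun i h0 hi => hy i h0 (by omega))
    (fun a b => if a ≠ b then 1 else 0)
  have hi (b : C) (i : ℕ) (hi : i ∈ Finset.range m) :
      ∑ a, y a ^ (i + 1) * y b ^ (m - i) * (if a ≠ b then 1 else 0) = - y b ^ (m + 1) := by
    have h0 := hy (i + 1) (by omega) (by have := Finset.mem_range.mp hi; omega)
    rw [← Finset.add_sum_erase _ _ (Finset.mem_univ b)] at h0 ⊢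
    have he : ∑ a ∈ Finset.univ.erase b, y a ^ (i + 1) * y b ^ (m - i) * (if a ≠ b then 1 else 0) =
        (∑ a ∈ Finset.univ.erase b, y a ^ (i + 1)) * y b ^ (m - i) := by
      rw [Finset.sum_mul]
      exact Finset.sum_congr rfl fun a ha => by simp [Finset.ne_of_mem_erase ha]
    have hp : y b ^ (m + 1) = y b ^ (i + 1) * y b ^ (m - i) := by
      rw [← pow_add]; congr 1; have := Finset.mem_range.mp hi; omega
    rw [he, hp]
    simp only [ne_eq, not_true_eq_false, if_false, mul_zero, zero_add]
    linear_combination y b ^ (m - i) * h0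
  rw [Finset.sum_congr rfl fun b _ => Finset.sum_congr rfl (hi b)] at h
  simp only [hcond, ite_and]
  simp only [mul_ite, mul_one, mul_zero] at h
  rw [h]
  simp only [ne_eq, not_true_eq_false, if_false, Finset.sum_const_zero, mul_zero, zero_add,
    Finset.sum_const, Finset.card_range, nsmul_eq_mul, ← Finset.mul_sum, Finset.sum_neg_distrib]
  push_cast
  ring

lemma sunGraph_proper_iff {n k : ℕ} (hn : 2 ≤ n) {C : Type}
    (κ : Fin n ⊕ ((_ : Fin n) × Fin k) → C) :
    (∀ u v, (sunGraph n fun _ => k).Adj u v → κ u ≠ κ v) ↔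
      (∀ i j : Fin n, (j : ℕ) = (i + 1) % n → κ (Sum.inl i) ≠ κ (Sum.inl j)) ∧
      ∀ i : Fin n, (∀ j : Fin k, (j : ℕ) = 0 → κ (Sum.inl i) ≠ κ (Sum.inr ⟨i, j⟩)) ∧
        ∀ j j' : Fin k, (j' : ℕ) = j + 1 → κ (Sum.inr ⟨i, j⟩) ≠ κ (Sum.inr ⟨i, j'⟩) := by
  simp only [sunGraph, SimpleGraph.fromRel_adj]
  constructor
  · intro h
    refine ⟨fun i j hij => h _ _ ⟨?_, Or.inl hij⟩, fun i =>
      ⟨fun j hj => h _ _ ⟨by simp, Or.inl ⟨rfl, hj⟩⟩, fun j j' hj => h _ _ ⟨?_, Or.inl ⟨rfl, hj⟩⟩⟩⟩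
    · rintro h
      have hj := Sum.inl.inj h
      subst hj
      rcases Nat.lt_or_ge (i + 1 : ℕ) n with h | h
      · rw [Nat.mod_eq_of_lt h] at hij
        omega
      · rw [show (i + 1 : ℕ) = n by omega, Nat.mod_self] at hij
        omega
    · rintro h
      have := congrArg Fin.val (eq_of_heq (Sigma.mk.inj (Sum.inr.inj h)).2)
      omega
  · rintro ⟨h1, h2⟩
    have key : ∀ u v, sunRel n (fun _ => k) (fun i i' => (i' : ℕ) = ((i : ℕ) + 1) % n) u v →
        κ u ≠ κ v := by
      rintro (i | ⟨i, j⟩) (i' | ⟨i', j'⟩) h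
      · exact h1 i i' h
      · obtain ⟨h, h'⟩ := h
        dsimp only at h h'
        subst h
        exact (h2 _).1 j' h'
      · exact h.elim
      · obtain ⟨h, h'⟩ := h
        dsimp only at h h'
        subst h
        exact (h2 _).2 j j' h'
    rintro u v ⟨_, h | h⟩
    · exact key u v h
    · exact (key v u h).symm

/-- Evaluating `X_{S(n;k)}` at a point where `p_1, …, p_k` and `p_{k+1}, p_{2(k+1)}, …,
p_{(n-1)(k+1)}` vanish gives a multiple of the power sum `p_{n(k+1)}`. -/
lemma aeval_properPoly_sunGraph {n k : ℕ} (hn : 2 ≤ n) {C : Type} [Fintype C] (x : C → ℂ)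
    (hx : ∀ m, 0 < m → m ≤ k → ∑ c, x c ^ m = 0)
    (hy : ∀ i, 0 < i → i < n → ∑ c, x c ^ ((k + 1) * i) = 0) :
    MvPolynomial.aeval x (properPoly (sunGraph n fun _ => k)) =
      (-1) ^ (n * (k + 1)) * (1 - n) * ∑ c, x c ^ (n * (k + 1)) := by
  classical
  simp only [properPoly, map_sum, map_prod, MvPolynomial.aeval_X]
  rw [Finset.sum_filter]
  let e : ((Fin n → C) × (Fin n → Fin k → C)) ≃ (Fin n ⊕ ((_ : Fin n) × Fin k) → C) :=
    ((Equiv.refl _).prodCongr (Equiv.piCurry fun (_ : Fin n) (_ : Fin k) => C).symm).trans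
      (Equiv.sumArrowEquivProdArrow _ _ _).symm
  rw [← @Equiv.sum_comp _ _ _ _ (_) _ e, Fintype.sum_prod_type]
  have hl (κ : Fin n → C) (ρ : Fin n → Fin k → C) (i : Fin n) : e (κ, ρ) (Sum.inl i) = κ i := rfl
  have hr (κ : Fin n → C) (ρ : Fin n → Fin k → C) (i : Fin n) (j : Fin k) :
      e (κ, ρ) (Sum.inr ⟨i, j⟩) = ρ i j := rfl
  have hsum (κ : Fin n → C) :
      (∑ ρ : Fin n → Fin k → C, if (∀ u v, (sunGraph n fun _ => k).Adj u v →
        e (κ, ρ) u ≠ e (κ, ρ) v) then ∏ v, x (e (κ, ρ) v) else 0) =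
      (-1) ^ (n * k) * if (∀ i j : Fin n, (j : ℕ) = (i + 1) % n → κ i ≠ κ j) then
        ∏ i, x (κ i) ^ (k + 1) else 0 := by
    simp only [sunGraph_proper_iff hn, Fintype.prod_sum_type, Fintype.prod_sigma, hl, hr]
    split_ifs with h
    · have hprod := Finset.prod_univ_sum (fun _ : Fin n => (Finset.univ : Finset (Fin k → C)))
        (fun i ρ => if (∀ j : Fin k, (j : ℕ) = 0 → κ i ≠ ρ j) ∧
          (∀ j j' : Fin k, (j' : ℕ) = j + 1 → ρ j ≠ ρ j') then ∏ j, x (ρ j) else 0)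
      simp only [sum_ray_colorings x k hx, Fintype.piFinset_univ, Finset.prod_ite_zero,
        Finset.mem_univ, true_imp_iff, Finset.prod_mul_distrib, Finset.prod_const, Finset.card_univ,
        Fintype.card_fin] at hprod
      simp only [and_iff_right h, pow_succ, Finset.prod_mul_distrib]
      rw [mul_comm n k, pow_mul, ← mul_assoc, hprod, mul_comm, Finset.mul_sum]
      refine Finset.sum_congr rfl fun ρ _ => ?_
      rw [mul_ite, mul_zero]
    · simp [h]
  have hcyc := sum_cycle_colorings (fun c => x c ^ (k + 1)) n (by omega)
    (fun i h0 hi => by simpa only [← pow_mul] using hy i h0 hi)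
  simp only [← pow_mul] at hcyc
  simp only [hsum]
  rw [← Finset.mul_sum, hcyc, mul_comm (k + 1) n]
  ring

/-- If `b < a < 2b`, the only multiset with entries in `{a, b}` and sum `a + b` is `{a, b}`. -/
lemma eq_pair_of_sum_eq {a b : ℕ} (hba : b < a) (hab : a < 2 * b) {μ : Multiset ℕ}
    (hμ : ∀ m ∈ μ, m = b ∨ m = a) (hs : μ.sum = a + b) : μ = {a, b} := by
  have hle : ∀ m ∈ μ, b ≤ m := fun m hm => by rcases hμ m hm with h | h <;> omega
  have hcard : μ.card * b ≤ a + b := by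
    simpa [hs] using Multiset.card_nsmul_le_sum hle
  have hlt : μ.card < 3 := by
    by_contra h
    have := Nat.mul_le_mul_right b (not_lt.mp h)
    omega
  interval_cases h : μ.card
  · rw [Multiset.card_eq_zero] at h
    subst h
    simp at hs
    omega
  · obtain ⟨p, rfl⟩ := Multiset.card_eq_one.mp h
    have := hμ p (by simp)
    simp at hs
    omega
  · obtain ⟨p, q, rfl⟩ := Multiset.card_eq_two.mp h
    have hp := hμ p (by simp)
    have hq := hμ q (by simp)
    simp only [Multiset.insert_eq_cons, Multiset.sum_cons, Multiset.sum_singleton] at hs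
    rcases hp with rfl | rfl
    · obtain rfl : q = a := by omega
      exact Multiset.pair_comm _ _
    · obtain rfl : q = b := by omega
      rfl

/-- The coefficient of `e_{(a, b)}` is obtained by evaluating at a point whose only nonzero
elementary symmetric functions are `e_0 = e_b = e_a = 1`. -/
lemma aeval_properPoly_eq_coeff {V : Type} [Fintype V] (G : SimpleGraph V) {a b : ℕ} (hba : b < a)
    (hab : a < 2 * b) (hV : Fintype.card V = a + b) (c : Multiset ℕ →₀ ℚ)
    (h0 : ∀ μ ∈ c.support, 0 ∉ μ) (hc : csf G = c.sum fun μ a => a • esymM μ) {M : ℕ}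
    {x : Fin M → ℂ} (hx : ∀ m, MvPolynomial.aeval x (MvPolynomial.esymm (Fin M) ℚ m) =
      if m = 0 ∨ m = b ∨ m = a then 1 else 0) :
    MvPolynomial.aeval x (properPoly G) = (c {a, b} : ℂ) := by
  rw [properPoly_eq_sum G M c hc, map_sum]
  simp only [map_smul, map_multiset_prod, Multiset.map_map, Function.comp_def, hx]
  rw [Finset.sum_eq_single {a, b}]
  · simp [Algebra.smul_def]
  · intro μ hμ hne
    rw [Finset.mem_filter, hV] at hμ
    have : ∃ m ∈ μ, ¬ (m = b ∨ m = a) := by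
      by_contra! h
      exact hne (eq_pair_of_sum_eq hba hab h hμ.2)
    obtain ⟨m, hm, hmab⟩ := this
    have hm0 : m ≠ 0 := fun h => h0 μ hμ.1 (h ▸ hm)
    rw [Multiset.prod_eq_zero, smul_zero]
    exact Multiset.mem_map.mpr ⟨m, hm, if_neg (by omega)⟩
  · intro h
    rw [Finset.mem_filter, not_and_or, Finsupp.notMem_support_iff, hV] at h
    rcases h with h | h
    · rw [h, zero_smul]
    · simp at h

lemma eCoeff_sunGraph {n k a b : ℕ} (hn : 3 ≤ n) (hk : 2 ≤ k) (hN : a + b = n * (k + 1))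
    (hba : b < a) (hab : a ≤ b + 2) (c : Multiset ℕ →₀ ℚ) (h0 : ∀ μ ∈ c.support, 0 ∉ μ)
    (hc : csf (sunGraph n fun _ => k) = c.sum fun μ a => a • esymM μ) :
    c {a, b} = n * (k + 1) * (1 - n) := by
  have hle : 3 * (k + 1) ≤ n * (k + 1) := Nat.mul_le_mul_right _ hn
  have ha2b : a < 2 * b := by omega
  have hV : Fintype.card (Fin n ⊕ ((_ : Fin n) × Fin k)) = a + b := by
    simp [hN]; ring
  obtain ⟨x, hx⟩ := exists_esymm_eq a b (by omega) hba
  have hdvd (i : ℕ) : (k + 1) * i ≠ b ∧ (k + 1) * i ≠ a := by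
    have hd : k + 1 ∣ a + b := hN ▸ Dvd.intro_left n rfl
    have hnot : ¬ k + 1 ∣ a - b := fun h => by
      have := Nat.le_of_dvd (by omega) h
      omega
    constructor
    · rintro rfl
      exact hnot (Nat.dvd_sub ((Nat.dvd_add_left (Dvd.intro i rfl)).mp hd) (Dvd.intro i rfl))
    · rintro rfl
      exact hnot (Nat.dvd_sub (Dvd.intro i rfl) ((Nat.dvd_add_right (Dvd.intro i rfl)).mp hd))
  have heval := aeval_properPoly_sunGraph (n := n) (k := k) (by omega) x
    (fun m h1 h2 => sum_pow_eq_zero_of_esymm hba ha2b hx h1 (by omega) (by omega) (by omega)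
      (by omega))
    (fun i h1 h2 => by
      have hi : (k + 1) * i + (k + 1) ≤ n * (k + 1) := by
        rw [← mul_add_one, mul_comm n]
        exact Nat.mul_le_mul_left _ h2
      exact sum_pow_eq_zero_of_esymm hba ha2b hx (by positivity) (by omega) (hdvd i).1 (hdvd i).2
        (by omega))
  rw [aeval_properPoly_eq_coeff _ hba ha2b hV c h0 hc hx, ← hN, sum_pow_add_of_esymm hba ha2b hx]
    at heval
  have hs : ((-1 : ℂ) ^ (a + b)) * (-1) ^ (a + b) = 1 := by
    rw [← mul_pow]; simp
  have hN' : (a + b : ℂ) = n * (k + 1) := by exact_mod_cast hN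
  have : (c {a, b} : ℂ) = ((n * (k + 1) * (1 - n) : ℚ) : ℂ) := by
    rw [heval]
    push_cast
    linear_combination (1 - n : ℂ) * (a + b) * hs + (1 - n : ℂ) * hN'
  exact_mod_cast this

/-- For `n ≥ 3` and `k ≥ 2`: if `n(k+1)` is even, then
`[e_{(n(k+1)/2+1, n(k+1)/2-1)}] X_{S(n;k)} = n(k+1)(1-n)`; if `n(k+1)` is odd, then
`[e_{((n(k+1)+1)/2, (n(k+1)-1)/2)}] X_{S(n;k)} = n(k+1)(1-n)`. -/
theorem sun_equal_rays_eCoeff (n k : ℕ) (hn : 3 ≤ n) (hk : 2 ≤ k) :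
    (Even (n * (k + 1)) → ∀ c : Multiset ℕ →₀ ℚ, (∀ μ ∈ c.support, 0 ∉ μ) →
      csf (sunGraph n fun _ => k) = (c.sum fun μ a => a • esymM μ) →
      c {n * (k + 1) / 2 + 1, n * (k + 1) / 2 - 1} = n * (k + 1) * (1 - n)) ∧
    (Odd (n * (k + 1)) → ∀ c : Multiset ℕ →₀ ℚ, (∀ μ ∈ c.support, 0 ∉ μ) →
      csf (sunGraph n fun _ => k) = (c.sum fun μ a => a • esymM μ) →
      c {(n * (k + 1) + 1) / 2, (n * (k + 1) - 1) / 2} = n * (k + 1) * (1 - n)) := by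
  refine ⟨fun he c h0 hc => ?_, fun ho c h0 hc => ?_⟩
  · have hle : 3 * (k + 1) ≤ n * (k + 1) := Nat.mul_le_mul_right _ hn
    obtain ⟨r, hr⟩ := he
    exact eCoeff_sunGraph hn hk (by omega) (by omega) (by omega) c h0 hc
  · obtain ⟨r, hr⟩ := ho
    exact eCoeff_sunGraph hn hk (by omega) (by omega) (by omega) c h0 hc
end

section
/- Let λ_1,…,λ_n be positive integers with λ_1 = max{λ_1,…,λ_n} and λ_1 + 2 ≤ λ_2 + ⋯ + λ_n + n − 2. If gcd(λ_1+1, λ_2+1, …, λ_n+1) = m > 1, then neither the sun graph S(n; λ_1,…,λ_n) nor the complete sun graph S̄(n; λ_1,…,λ_n) admits a connected partition of type (λ_2 + ⋯ + λ_n + n − 2, λ_1 + 2); consequently neither graph is e-positive. -/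
/-- The image of the variable `x_i` under the specialization sending `x_0, …, x_{N-1}` to `X 0`,
`x_N, …, x_{2N-1}` to `X 1`, and all other variables to `0`. -/
noncomputable def blockVar (N i : ℕ) : MvPowerSeries (Fin 2) ℚ :=
  if i < N then MvPowerSeries.X 0 else if i < 2 * N then MvPowerSeries.X 1 else 0

theorem hasSubst_blockVar (N : ℕ) : MvPowerSeries.HasSubst (blockVar N) where
  const_coeff i := by
    unfold blockVar
    split_ifs <;> simp
  coeff_zero e := by
    refine (Set.finite_lt_nat (2 * N)).subset fun i hi => ?_
    by_contra h
    simp only [Set.mem_ofPred_eq, not_lt] at h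
    simp [blockVar, show ¬ i < N by omega, show ¬ i < 2 * N by omega] at hi

/-- The specialization homomorphism associated with `blockVar`. -/
noncomputable def blockHom (N : ℕ) : MvPowerSeries ℕ ℚ →ₐ[ℚ] MvPowerSeries (Fin 2) ℚ :=
  MvPowerSeries.substAlgHom (hasSubst_blockVar N)

/-- The exponents of the monomials sent to `X ^ e` by `blockHom N`. -/
noncomputable def blockExps (N : ℕ) (e : Fin 2 →₀ ℕ) : Finset (ℕ →₀ ℕ) :=
  (Finset.finsuppAntidiag (Finset.range (2 * N)) (e 0 + e 1)).filter fun d =>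
    ∑ i ∈ Finset.range N, d i = e 0 ∧ ∑ i ∈ Finset.Ico N (2 * N), d i = e 1

theorem mem_blockExps {N : ℕ} {e : Fin 2 →₀ ℕ} {d : ℕ →₀ ℕ} :
    d ∈ blockExps N e ↔ d.support ⊆ Finset.range (2 * N) ∧
      ∑ i ∈ Finset.range N, d i = e 0 ∧ ∑ i ∈ Finset.Ico N (2 * N), d i = e 1 := by
  simp only [blockExps, Finset.mem_filter, Finset.mem_finsuppAntidiag]
  have := Finset.sum_range_add_sum_Ico d (show N ≤ 2 * N by omega)
  constructor
  · tauto
  · rintro ⟨h1, h2, h3⟩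
    exact ⟨⟨by rw [← this, h2, h3], h1⟩, h2, h3⟩

theorem coeff_prod_blockVar (N : ℕ) (e : Fin 2 →₀ ℕ) (d : ℕ →₀ ℕ) :
    MvPowerSeries.coeff e (d.prod fun i k => blockVar N i ^ k) =
      if d ∈ blockExps N e then 1 else 0 := by
  by_cases hd : d.support ⊆ Finset.range (2 * N)
  · have h1 : (d.prod fun i k => blockVar N i ^ k) =
        MvPowerSeries.X 0 ^ (∑ i ∈ Finset.range N, d i) *
          MvPowerSeries.X 1 ^ (∑ i ∈ Finset.Ico N (2 * N), d i) := by
      rw [Finsupp.prod_of_support_subset d hd _ (by simp),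
        ← Finset.prod_range_mul_prod_Ico _ (show N ≤ 2 * N by omega),
        ← Finset.prod_pow_eq_pow_sum, ← Finset.prod_pow_eq_pow_sum]
      congr 1
      · refine Finset.prod_congr rfl fun i hi => ?_
        simp [blockVar, Finset.mem_range.1 hi]
      · refine Finset.prod_congr rfl fun i hi => ?_
        have := Finset.mem_Ico.1 hi
        simp [blockVar, show ¬ i < N by omega, this.2]
    rw [h1, MvPowerSeries.X_pow_eq, MvPowerSeries.X_pow_eq, MvPowerSeries.monomial_mul_monomial,
      MvPowerSeries.coeff_monomial, one_mul]
    refine if_congr ?_ rfl rfl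
    rw [mem_blockExps]
    simp only [hd, true_and, Finsupp.ext_iff, Fin.forall_fin_two]
    simp [eq_comm]
  · rw [if_neg fun h => hd (mem_blockExps.1 h).1]
    obtain ⟨i, hi, hi'⟩ := Finset.not_subset.1 hd
    have h0 : (d.prod fun i k => blockVar N i ^ k) = 0 := by
      refine Finset.prod_eq_zero hi ?_
      have : ¬ i < 2 * N := by simpa using hi'
      simp [blockVar, show ¬ i < N by omega, this, Finsupp.mem_support_iff.1 hi]
    rw [h0, map_zero]

theorem coeff_blockHom (N : ℕ) (e : Fin 2 →₀ ℕ) (f : MvPowerSeries ℕ ℚ) :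
    MvPowerSeries.coeff e (blockHom N f) = ∑ d ∈ blockExps N e, f d := by
  rw [blockHom, MvPowerSeries.substAlgHom_apply, MvPowerSeries.coeff_subst (hasSubst_blockVar N)]
  simp only [coeff_prod_blockVar]
  rw [finsum_eq_sum_of_support_subset (s := blockExps N e)]
  · exact Finset.sum_congr rfl fun d hd => by simp [hd, MvPowerSeries.coeff_apply]
  · intro d hd
    by_contra h
    simp at h
    simp [h] at hd

/-- The binomial coefficient `N.choose j` as a polynomial in `N`. -/
noncomputable def choosePoly (j : ℕ) : Polynomial ℚ :=
  Polynomial.C ((j.factorial : ℚ)⁻¹) * descPochhammer ℚ j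

theorem eval_choosePoly (N j : ℕ) : (choosePoly j).eval (N : ℚ) = N.choose j := by
  rw [choosePoly, Polynomial.eval_mul, Polynomial.eval_C, descPochhammer_eval_eq_descFactorial,
    Nat.descFactorial_eq_factorial_mul_choose, Nat.cast_mul,
    inv_mul_cancel_left₀ (by positivity)]

/-- A family of polynomials in `N` interpolating `blockHom N (esym k)`. -/
noncomputable def esymPoly (k : ℕ) : MvPowerSeries (Fin 2) (Polynomial ℚ) :=
  fun e => if e 0 + e 1 = k then choosePoly (e 0) * choosePoly (e 1) else 0

theorem coeff_esymPoly (k : ℕ) (e : Fin 2 →₀ ℕ) : MvPowerSeries.coeff e (esymPoly k) =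
    if e 0 + e 1 = k then choosePoly (e 0) * choosePoly (e 1) else 0 := rfl

theorem card_squarefree_blockExps (N : ℕ) (e : Fin 2 →₀ ℕ) :
    ((blockExps N e).filter fun d => ∀ i ∈ d.support, d i = 1).card =
      N.choose (e 0) * N.choose (e 1) := by
  have h1 : (Finset.powersetCard (e 0) (Finset.range N) ×ˢ
      Finset.powersetCard (e 1) (Finset.Ico N (2 * N))).card =
      N.choose (e 0) * N.choose (e 1) := by
    rw [Finset.card_product, Finset.card_powersetCard, Finset.card_powersetCard]
    simp [two_mul]
  rw [← h1]
  symm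
  have hsum : ∀ (d : ℕ →₀ ℕ) (s : Finset ℕ), (∀ i ∈ d.support, d i = 1) →
      ∑ i ∈ s, d i = (d.support ∩ s).card := by
    intro d s hd
    rw [Finset.card_eq_sum_ones, Finset.inter_comm, ← Finset.filter_mem_eq_inter,
      Finset.sum_filter]
    refine Finset.sum_congr rfl fun i _ => ?_
    split_ifs with h
    · exact hd i h
    · simpa using h
  have hpart : ∀ p : Finset ℕ × Finset ℕ, p ∈ Finset.powersetCard (e 0) (Finset.range N) ×ˢ
      Finset.powersetCard (e 1) (Finset.Ico N (2 * N)) →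
      (p.1 ∪ p.2) ∩ Finset.range N = p.1 ∧ (p.1 ∪ p.2) ∩ Finset.Ico N (2 * N) = p.2 := by
    intro p hp
    simp only [Finset.mem_product, Finset.mem_powersetCard] at hp
    have h1 : ∀ x ∈ p.1, x < N := fun x hx => by simpa using hp.1.1 hx
    have h2 : ∀ x ∈ p.2, N ≤ x ∧ x < 2 * N := fun x hx => by simpa using hp.2.1 hx
    constructor <;> ext x <;> simp only [Finset.mem_inter, Finset.mem_union, Finset.mem_range,
      Finset.mem_Ico]
    · constructor
      · rintro ⟨h | h, h'⟩
        · exact h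
        · have := h2 x h; omega
      · exact fun h => ⟨Or.inl h, h1 x h⟩
    · constructor
      · rintro ⟨h | h, h'⟩
        · have := h1 x h; omega
        · exact h
      · exact fun h => ⟨Or.inr h, h2 x h⟩
  refine Finset.card_bij' (fun p _ => Finsupp.indicator (p.1 ∪ p.2) fun _ _ => 1)
    (fun d _ => (d.support ∩ Finset.range N, d.support ∩ Finset.Ico N (2 * N))) ?_ ?_ ?_ ?_
  · intro p hp
    have hs : (Finsupp.indicator (p.1 ∪ p.2) fun _ _ => (1 : ℕ)).support = p.1 ∪ p.2 := by
      ext x; simp [Finsupp.indicator_apply, or_iff_not_imp_left]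
    have h1 : ∀ i ∈ (Finsupp.indicator (p.1 ∪ p.2) fun _ _ => (1 : ℕ)).support,
        (Finsupp.indicator (p.1 ∪ p.2) fun _ _ => (1 : ℕ)) i = 1 := by
      intro i hi
      rw [hs] at hi
      exact Finsupp.indicator_of_mem hi _
    rw [Finset.mem_filter, mem_blockExps, hsum _ _ h1, hsum _ _ h1]
    refine ⟨?_, h1⟩
    rw [hs, (hpart p hp).1, (hpart p hp).2]
    simp only [Finset.mem_product, Finset.mem_powersetCard] at hp
    refine ⟨?_, hp.1.2, hp.2.2⟩
    refine Finset.union_subset (hp.1.1.trans ?_) (hp.2.1.trans ?_)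
    · exact Finset.range_subset_range.2 (by omega)
    · intro x hx
      simp at hx ⊢
      omega
  · intro d hd
    rw [Finset.mem_filter, mem_blockExps] at hd
    obtain ⟨⟨h0, h1, h2⟩, h3⟩ := hd
    rw [hsum _ _ h3] at h1 h2
    simp only [Finset.mem_product, Finset.mem_powersetCard]
    exact ⟨⟨Finset.inter_subset_right, h1⟩, Finset.inter_subset_right, h2⟩
  · intro p hp
    have hs : (Finsupp.indicator (p.1 ∪ p.2) fun _ _ => (1 : ℕ)).support = p.1 ∪ p.2 := by
      ext x; simp [Finsupp.indicator_apply, or_iff_not_imp_left]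
    simp only [hs, hpart p hp]
  · intro d hd
    rw [Finset.mem_filter, mem_blockExps] at hd
    obtain ⟨⟨h0, h1, h2⟩, h3⟩ := hd
    ext i
    have hu : d.support ∩ Finset.range N ∪ d.support ∩ Finset.Ico N (2 * N) = d.support := by
      rw [← Finset.inter_union_distrib_left]
      refine Finset.inter_eq_left.2 fun x hx => ?_
      have := h0 hx
      simp at this ⊢
      omega
    simp only [hu, Finsupp.indicator_apply]
    split_ifs with h
    · exact (h3 i h).symm
    · simpa using (Finsupp.notMem_support_iff.1 h).symm

theorem blockHom_esym (N k : ℕ) :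
    blockHom N (esym k) = MvPowerSeries.map (Polynomial.evalRingHom (N : ℚ)) (esymPoly k) := by
  ext e
  rw [coeff_blockHom, MvPowerSeries.coeff_map, coeff_esymPoly]
  have hdeg : ∀ d ∈ blockExps N e, (d.sum fun _ v => v) = e 0 + e 1 := by
    intro d hd
    rw [blockExps, Finset.mem_filter, Finset.mem_finsuppAntidiag'] at hd
    exact hd.1.1
  split_ifs with hk
  · rw [Polynomial.coe_evalRingHom, Polynomial.eval_mul, eval_choosePoly, eval_choosePoly,
      ← Nat.cast_mul, ← card_squarefree_blockExps, Finset.card_filter, Nat.cast_sum]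
    refine Finset.sum_congr rfl fun d hd => ?_
    simp only [esym, hdeg d hd, hk, and_true]
    split_ifs <;> simp
  · rw [map_zero]
    refine Finset.sum_eq_zero fun d hd => ?_
    simp [esym, hdeg d hd, hk]

/-- The linear combination of products of `esymPoly`s with coefficients `c`. -/
noncomputable def blockPoly (c : Multiset ℕ →₀ ℚ) : MvPowerSeries (Fin 2) (Polynomial ℚ) :=
  c.sum fun μ a => a • (μ.map esymPoly).prod

theorem blockHom_sum (N : ℕ) (c : Multiset ℕ →₀ ℚ) :
    blockHom N (c.sum fun μ a => a • esymM μ) =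
      MvPowerSeries.map (Polynomial.evalRingHom (N : ℚ)) (blockPoly c) := by
  rw [blockPoly, Finsupp.sum, Finsupp.sum, map_sum, map_sum]
  refine Finset.sum_congr rfl fun μ _ => ?_
  have h : blockHom N (esymM μ) =
      MvPowerSeries.map (Polynomial.evalRingHom (N : ℚ)) (μ.map esymPoly).prod := by
    rw [esymM, map_multiset_prod, map_multiset_prod, Multiset.map_map, Multiset.map_map]
    exact congrArg _ (Multiset.map_congr rfl fun k _ => blockHom_esym N k)
  rw [map_smul, h]
  ext e
  simp

/-- The coefficient of `N ^ k X ^ e` has the sign `(-1) ^ (k + |e|)`, or vanishes. -/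
def IsAlternating (f : MvPowerSeries (Fin 2) (Polynomial ℚ)) : Prop :=
  ∀ e k, 0 ≤ (-1) ^ (k + (e 0 + e 1)) * (MvPowerSeries.coeff e f).coeff k

theorem IsAlternating.one : IsAlternating 1 := by
  intro e k
  rw [MvPowerSeries.coeff_one]
  split_ifs with h
  · subst h
    rw [Polynomial.coeff_one]
    split_ifs with h
    · simp [h]
    · simp
  · simp

theorem IsAlternating.mul {f g : MvPowerSeries (Fin 2) (Polynomial ℚ)} (hf : IsAlternating f)
    (hg : IsAlternating g) : IsAlternating (f * g) := by
  intro e k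
  rw [MvPowerSeries.coeff_mul, Polynomial.finsetSum_coeff, Finset.mul_sum]
  refine Finset.sum_nonneg fun p hp => ?_
  rw [Polynomial.coeff_mul, Finset.mul_sum]
  refine Finset.sum_nonneg fun q hq => ?_
  have h1 := Finset.HasAntidiagonal.mem_antidiagonal.1 hp
  have h2 := Finset.HasAntidiagonal.mem_antidiagonal.1 hq
  rw [← h1, ← h2]
  convert mul_nonneg (hf p.1 q.1) (hg p.2 q.2) using 1
  simp only [Finsupp.add_apply]
  ring

theorem choosePoly_alternating (j k : ℕ) : 0 ≤ (-1) ^ (k + j) * (choosePoly j).coeff k := by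
  rw [choosePoly, Polynomial.coeff_C_mul, mul_left_comm]
  refine mul_nonneg (by positivity) ?_
  induction j generalizing k with
  | zero =>
    rw [descPochhammer_zero, Polynomial.coeff_one]
    split_ifs with h
    · simp [h]
    · simp
  | succ j ih =>
    rw [descPochhammer_succ_right, mul_sub, Polynomial.coeff_sub, Polynomial.coeff_mul_natCast]
    cases k with
    | zero =>
      rw [Polynomial.coeff_mul_X_zero]
      have := mul_nonneg (ih 0) (Nat.cast_nonneg (α := ℚ) j)
      convert this using 1
      ring
    | succ k =>
      rw [Polynomial.coeff_mul_X]
      have := add_nonneg (ih k) (mul_nonneg (ih (k + 1)) (Nat.cast_nonneg (α := ℚ) j))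
      convert this using 1
      ring

theorem coeff_one_descPochhammer_ne_zero {j : ℕ} (hj : 0 < j) :
    (descPochhammer ℚ j).coeff 1 ≠ 0 := by
  obtain ⟨j, rfl⟩ := Nat.exists_eq_add_of_lt hj
  rw [zero_add, descPochhammer_succ_left, Polynomial.coeff_X_mul,
    Polynomial.coeff_zero_eq_eval_zero, Polynomial.eval_comp, descPochhammer_eval_eq_prod_range]
  refine Finset.prod_ne_zero_iff.2 fun i _ => ?_
  have : (0 : ℚ) ≤ i := Nat.cast_nonneg i
  simp only [Polynomial.eval_sub, Polynomial.eval_X, Polynomial.eval_one]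
  linarith

theorem coeff_one_choosePoly_ne_zero {j : ℕ} (hj : 0 < j) : (choosePoly j).coeff 1 ≠ 0 := by
  rw [choosePoly, Polynomial.coeff_C_mul]
  exact mul_ne_zero (by positivity) (coeff_one_descPochhammer_ne_zero hj)

theorem choosePoly_coeff_zero {j : ℕ} (hj : 0 < j) : (choosePoly j).coeff 0 = 0 := by
  rw [choosePoly, Polynomial.coeff_C_mul, Polynomial.coeff_zero_eq_eval_zero,
    descPochhammer_ne_zero_eval_zero _ hj.ne', mul_zero]

theorem esymPoly_alternating (m : ℕ) : IsAlternating (esymPoly m) := by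
  intro e k
  rw [coeff_esymPoly]
  split_ifs
  · rw [Polynomial.coeff_mul, Finset.mul_sum]
    refine Finset.sum_nonneg fun q hq => ?_
    rw [← Finset.HasAntidiagonal.mem_antidiagonal.1 hq]
    convert mul_nonneg (choosePoly_alternating (e 0) q.1) (choosePoly_alternating (e 1) q.2) using 1
    ring
  · simp

theorem prod_esymPoly_alternating (μ : Multiset ℕ) : IsAlternating (μ.map esymPoly).prod :=
  Multiset.prod_induction _ _ (fun _ _ => IsAlternating.mul) IsAlternating.one (by
    simp only [Multiset.mem_map]
    rintro _ ⟨m, _, rfl⟩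
    exact esymPoly_alternating m)

theorem coeff_coeff_blockPoly (c : Multiset ℕ →₀ ℚ) (e : Fin 2 →₀ ℕ) (k : ℕ) :
    (MvPowerSeries.coeff e (blockPoly c)).coeff k =
      c.sum fun μ a => a * (MvPowerSeries.coeff e (μ.map esymPoly).prod).coeff k := by
  simp [blockPoly, Finsupp.sum, map_sum, Polynomial.finsetSum_coeff]

/-- The exponent of `X 0 ^ a * X 1 ^ b`. -/
noncomputable def pairExp (a b : ℕ) : Fin 2 →₀ ℕ := Finsupp.single 0 a + Finsupp.single 1 b

@[simp] theorem pairExp_zero (a b : ℕ) : pairExp a b 0 = a := by simp [pairExp]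

@[simp] theorem pairExp_one (a b : ℕ) : pairExp a b 1 = b := by simp [pairExp]

theorem coeff_singleton_eq_zero_of_coeff_two {c : Multiset ℕ →₀ ℚ} (hc : ∀ μ, 0 ≤ c μ) {a b : ℕ}
    (ha : 0 < a) (hb : 0 < b)
    (h : (MvPowerSeries.coeff (pairExp a b) (blockPoly c)).coeff 2 = 0) : c {a + b} = 0 := by
  have h' : c.sum (fun μ x => (-1) ^ (2 + (pairExp a b 0 + pairExp a b 1)) *
      (x * (MvPowerSeries.coeff (pairExp a b) (μ.map esymPoly).prod).coeff 2)) = 0 := by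
    rw [← Finsupp.mul_sum, ← coeff_coeff_blockPoly, h, mul_zero]
  rw [Finsupp.sum, Finset.sum_eq_zero_iff_of_nonneg] at h'
  · by_contra hne
    have := h' {a + b} (Finsupp.mem_support_iff.2 hne)
    simp only [Multiset.map_singleton, Multiset.prod_singleton, coeff_esymPoly, pairExp_zero,
      pairExp_one, if_true] at this
    have h2 : (choosePoly a * choosePoly b).coeff 2 =
        (choosePoly a).coeff 1 * (choosePoly b).coeff 1 := by
      rw [Polynomial.coeff_mul]
      simp [Finset.Nat.antidiagonal_succ, choosePoly_coeff_zero ha, choosePoly_coeff_zero hb]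
    rw [h2] at this
    have h3 := coeff_one_choosePoly_ne_zero ha
    have h4 := coeff_one_choosePoly_ne_zero hb
    have h5 : ((-1 : ℚ)) ^ (2 + (a + b)) ≠ 0 := pow_ne_zero _ (by norm_num)
    simp_all
  · intro μ _
    have := mul_nonneg (hc μ) (prod_esymPoly_alternating μ (pairExp a b) 2)
    rwa [mul_left_comm] at this

theorem C_X_dvd_esymPoly {k : ℕ} (hk : 0 < k) :
    (MvPowerSeries.C Polynomial.X : MvPowerSeries (Fin 2) (Polynomial ℚ)) ∣ esymPoly k := by
  have h : ∀ e, Polynomial.X ∣ MvPowerSeries.coeff e (esymPoly k) := by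
    intro e
    rw [coeff_esymPoly]
    split_ifs with he
    · rcases Nat.eq_zero_or_pos (e 0) with h0 | h0
      · exact Dvd.dvd.mul_left (Polynomial.X_dvd_iff.2 (choosePoly_coeff_zero (by omega))) _
      · exact Dvd.dvd.mul_right (Polynomial.X_dvd_iff.2 (choosePoly_coeff_zero h0)) _
    · exact dvd_zero _
  choose g hg using h
  obtain ⟨G, hG⟩ : ∃ G : MvPowerSeries (Fin 2) (Polynomial ℚ),
      ∀ e, MvPowerSeries.coeff e G = g e := ⟨g, fun _ => rfl⟩
  refine ⟨G, ?_⟩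
  ext1 e
  rw [MvPowerSeries.coeff_C_mul, hg e, hG e]

theorem coeff_one_eq_zero_of_coeff_singleton {c : Multiset ℕ →₀ ℚ} (hc : ∀ μ ∈ c.support, 0 ∉ μ)
    {d : ℕ} (hd : 0 < d) (h : c {d} = 0) :
    (MvPowerSeries.coeff (pairExp d 0) (blockPoly c)).coeff 1 = 0 := by
  rw [coeff_coeff_blockPoly]
  refine Finset.sum_eq_zero fun μ hμ => ?_
  refine mul_eq_zero_of_right _ ?_
  have h0 := hc μ hμ
  induction μ using Multiset.induction with
  | empty =>
    rw [Multiset.map_zero, Multiset.prod_zero, MvPowerSeries.coeff_one, if_neg, Polynomial.coeff_zero]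
    intro h
    have := DFunLike.congr_fun h 0
    simp at this
    omega
  | cons k ν _ =>
    induction ν using Multiset.induction with
    | empty =>
      have hk : d ≠ k := by
        rintro rfl
        exact Finsupp.mem_support_iff.1 hμ h
      simp [coeff_esymPoly, hk]
    | cons l ν _ =>
      simp only [Multiset.mem_cons, not_or] at h0
      rw [Multiset.map_cons, Multiset.map_cons, Multiset.prod_cons, Multiset.prod_cons, ← mul_assoc]
      obtain ⟨g, hg⟩ := (mul_dvd_mul (C_X_dvd_esymPoly (Nat.pos_of_ne_zero (Ne.symm h0.1)))
        (C_X_dvd_esymPoly (Nat.pos_of_ne_zero (Ne.symm h0.2.1)))).mul_right (ν.map esymPoly).prod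
      rw [hg, mul_assoc, MvPowerSeries.coeff_C_mul, MvPowerSeries.coeff_C_mul,
        Polynomial.coeff_X_mul, Polynomial.coeff_X_mul_zero]

theorem coeff_zero_eq_zero_of_dvd_eval (Q : Polynomial ℚ)
    (h : ∀ N : ℕ, 0 < N → ∃ z : ℤ, Q.eval (N : ℚ) = N * z) : Q.coeff 0 = 0 := by
  obtain ⟨D, hDM, hD⟩ := IsLocalization.integerNormalization_spec (nonZeroDivisors ℤ) Q
  set p := IsLocalization.integerNormalization (nonZeroDivisors ℤ) Q
  have hD0 : D ≠ 0 := nonZeroDivisors.ne_zero hDM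
  have hp : p.map (algebraMap ℤ ℚ) = Polynomial.C (D : ℚ) * Q := by
    rw [hD]
    ext i
    simp
  have hdvd : ∀ N : ℕ, 0 < N → (N : ℤ) ∣ p.coeff 0 := by
    intro N hN
    obtain ⟨z, hz⟩ := h N hN
    have h1 : p.eval (N : ℤ) = D * (N * z) := by
      have := congrArg (Polynomial.eval (N : ℚ)) hp
      rw [Polynomial.eval_mul, Polynomial.eval_C, hz] at this
      have h2 := Polynomial.eval_intCast_map (algebraMap ℤ ℚ) p N
      rw [Int.cast_natCast] at h2
      rw [h2] at this
      simp only [algebraMap_int_eq, eq_intCast] at this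
      exact_mod_cast this
    have h2 := Polynomial.sub_dvd_eval_sub (N : ℤ) 0 p
    rw [sub_zero, h1, ← Polynomial.coeff_zero_eq_eval_zero] at h2
    have h3 : (N : ℤ) ∣ D * (N * z) := ⟨D * z, by ring⟩
    simpa using dvd_sub h3 h2
  have hp0 : p.coeff 0 = 0 := by
    by_contra hne
    have := Int.natAbs_dvd_natAbs.2 (hdvd ((p.coeff 0).natAbs + 1) (by omega))
    rw [Int.natAbs_natCast] at this
    have := Nat.le_of_dvd (Int.natAbs_pos.2 hne) this
    omega
  have h3 := congrArg (fun q => Polynomial.coeff q 0) hp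
  simp only [Polynomial.coeff_map, hp0, map_zero, Polynomial.coeff_C_mul] at h3
  rcases mul_eq_zero.1 h3.symm with h4 | h4
  · exact absurd (by exact_mod_cast h4) hD0
  · exact h4

theorem X_pow_dvd_of_pow_dvd_eval (k : ℕ) (Q : Polynomial ℚ)
    (h : ∀ N : ℕ, 0 < N → ∃ z : ℤ, Q.eval (N : ℚ) = N ^ k * z) : Polynomial.X ^ k ∣ Q := by
  induction k with
  | zero => simp
  | succ k ih =>
    obtain ⟨P, hP⟩ := ih fun N hN => by
      obtain ⟨z, hz⟩ := h N hN
      exact ⟨N * z, by rw [hz]; push_cast; ring⟩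
    have h0 : P.coeff 0 = 0 := by
      refine coeff_zero_eq_zero_of_dvd_eval P fun N hN => ?_
      obtain ⟨z, hz⟩ := h N hN
      refine ⟨z, ?_⟩
      rw [hP, Polynomial.eval_mul, Polynomial.eval_pow, Polynomial.eval_X, pow_succ, mul_assoc] at hz
      exact mul_left_cancel₀ (by positivity) hz
    obtain ⟨R, hR⟩ := Polynomial.X_dvd_iff.2 h0
    exact ⟨R, by rw [hP, hR]; ring⟩

/-- The number of proper colourings of `G` with colours in `A`. -/
noncomputable def numColorings {V : Type} (G : SimpleGraph V) (A : Type) : ℕ :=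
  Nat.card {κ : V → A // ∀ u v, G.Adj u v → κ u ≠ κ v}

theorem numColorings_congr {V : Type} (G : SimpleGraph V) {A B : Type} (f : A ≃ B) :
    numColorings G A = numColorings G B :=
  Nat.card_congr <| (Equiv.arrowCongr (Equiv.refl V) f).subtypeEquiv fun κ => by simp

/-- The graph obtained from `G` by deleting the edges between `S` and its complement. -/
def splitGraph {V : Type} (G : SimpleGraph V) (S : Finset V) : SimpleGraph V where
  Adj u v := G.Adj u v ∧ (u ∈ S ↔ v ∈ S)
  symm := ⟨fun _ _ h => ⟨h.1.symm, h.2.symm⟩⟩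
  loopless := ⟨fun _ h => G.irrefl h.1⟩

/-- The number of times each colour is used by `κ`. -/
noncomputable def colorType {V : Type} [Fintype V] (κ : V → ℕ) : ℕ →₀ ℕ :=
  ∑ v, Finsupp.single (κ v) 1

theorem sum_colorType {V : Type} [Fintype V] (κ : V → ℕ) (s : Finset ℕ) :
    ∑ i ∈ s, colorType κ i = (Finset.univ.filter fun v => κ v ∈ s).card := by
  simp only [colorType, Finsupp.finsetSum_apply]
  rw [Finset.sum_comm, Finset.card_filter]
  refine Finset.sum_congr rfl fun v _ => ?_
  simp [Finsupp.single_apply]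

theorem colorType_apply {V : Type} [Fintype V] (κ : V → ℕ) (i : ℕ) :
    colorType κ i = Nat.card {v : V // κ v = i} := by
  have := sum_colorType κ {i}
  rw [Finset.sum_singleton] at this
  rw [this, Nat.subtype_card (Finset.univ.filter fun v => κ v ∈ ({i} : Finset ℕ))]
  simp

theorem colorType_mem_blockExps {V : Type} [Fintype V] (κ : V → ℕ) (N : ℕ) (e : Fin 2 →₀ ℕ) :
    colorType κ ∈ blockExps N e ↔ (∀ v, κ v < 2 * N) ∧
      (Finset.univ.filter fun v => κ v < N).card = e 0 ∧
      (Finset.univ.filter fun v => ¬ κ v < N).card = e 1 := by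
  rw [mem_blockExps, sum_colorType, sum_colorType]
  have h1 : (colorType κ).support ⊆ Finset.range (2 * N) ↔ ∀ v, κ v < 2 * N := by
    constructor
    · intro h v
      refine Finset.mem_range.1 (h (Finsupp.mem_support_iff.2 ?_))
      have : 0 < Nat.card {w : V // κ w = κ v} := Nat.card_pos_iff.2 ⟨⟨v, rfl⟩, inferInstance⟩
      rw [colorType_apply]
      exact this.ne'
    · intro h i hi
      rw [Finsupp.mem_support_iff, colorType_apply] at hi
      obtain ⟨⟨v, hv⟩⟩ := (Nat.card_pos_iff.1 (Nat.pos_of_ne_zero hi)).1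
      rw [Finset.mem_range, ← hv]
      exact h v
  rw [h1]
  refine and_congr_right fun h => ?_
  have h2 : (Finset.univ.filter fun v => κ v ∈ Finset.Ico N (2 * N)) =
      Finset.univ.filter fun v => ¬ κ v < N := by
    refine Finset.filter_congr fun v _ => ?_
    simp [h v]
  rw [h2]
  simp only [Finset.mem_range]

open Classical in
theorem coeff_blockHom_csf {V : Type} [Fintype V] (G : SimpleGraph V) (N : ℕ)
    (e : Fin 2 →₀ ℕ) : MvPowerSeries.coeff e (blockHom N (csf G)) =
      ∑ S ∈ Finset.univ.filter fun S : Finset V => S.card = e 0 ∧ Sᶜ.card = e 1,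
        (numColorings (splitGraph G S) (Fin N) : ℚ) := by
  set K := (Fintype.piFinset fun _ : V => Finset.range (2 * N)).filter fun κ =>
    (∀ u v : V, G.Adj u v → κ u ≠ κ v) ∧ colorType κ ∈ blockExps N e with hK
  have hmem : ∀ κ, κ ∈ K ↔
      (∀ u v : V, G.Adj u v → κ u ≠ κ v) ∧ colorType κ ∈ blockExps N e := by
    intro κ
    rw [hK, Finset.mem_filter, Fintype.mem_piFinset]
    refine and_iff_right_of_imp fun h v => ?_
    exact Finset.mem_range.2 (((colorType_mem_blockExps κ N e).1 h.2).1 v)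
  have hl : MvPowerSeries.coeff e (blockHom N (csf G)) = K.card := by
    rw [coeff_blockHom, Finset.card_eq_sum_card_fiberwise (f := colorType) (t := blockExps N e)
      (fun κ hκ => ((hmem κ).1 hκ).2), Nat.cast_sum]
    refine Finset.sum_congr rfl fun d hd => ?_
    rw [csf, Nat.subtype_card (K.filter fun κ => colorType κ = d)]
    intro κ
    rw [Finset.mem_filter, hmem, Finsupp.ext_iff]
    simp only [← colorType_apply]
    constructor
    · exact fun h => ⟨h.1.1, h.2⟩
    · intro h
      refine ⟨⟨h.1, ?_⟩, h.2⟩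
      rwa [Finsupp.ext h.2]
  rw [hl, Finset.card_eq_sum_card_fiberwise (f := fun κ => Finset.univ.filter fun v => κ v < N)
      (t := Finset.univ.filter fun S : Finset V => S.card = e 0 ∧ Sᶜ.card = e 1), Nat.cast_sum]
  · refine Finset.sum_congr rfl fun S hS => ?_
    rw [Nat.cast_inj, ← Nat.card_eq_finsetCard, numColorings]
    obtain ⟨hS0, hS1⟩ := (Finset.mem_filter.1 hS).2
    have hmem' : ∀ κ, κ ∈ K.filter (fun κ => (Finset.univ.filter fun v => κ v < N) = S) ↔
        (∀ u v : V, G.Adj u v → κ u ≠ κ v) ∧ (∀ v, κ v < 2 * N) ∧ ∀ v, κ v < N ↔ v ∈ S := by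
      intro κ
      rw [Finset.mem_filter, hmem, colorType_mem_blockExps, Finset.filter_not]
      constructor
      · rintro ⟨⟨h1, h2, h3⟩, h4⟩
        exact ⟨h1, h2, fun v => by rw [← h4]; simp⟩
      · rintro ⟨h1, h2, h3⟩
        have h4 : (Finset.univ.filter fun v => κ v < N) = S := by ext v; simp [h3]
        refine ⟨⟨h1, h2, ?_⟩, h4⟩
        rw [h4, ← Finset.compl_eq_univ_sdiff]
        exact ⟨hS0, hS1⟩
    refine Nat.card_congr
      { toFun := fun κ => ⟨fun v => ⟨if v ∈ S then κ.1 v else κ.1 v - N, ?_⟩, ?_⟩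
        invFun := fun κ => ⟨fun v => if v ∈ S then κ.1 v else κ.1 v + N, ?_⟩
        left_inv := ?_
        right_inv := ?_ }
    · obtain ⟨h1, h2, h3⟩ := (hmem' _).1 κ.2
      have := h2 v
      have := h3 v
      split_ifs with h <;> simp [h] at this <;> omega
    · obtain ⟨h1, h2, h3⟩ := (hmem' _).1 κ.2
      intro u v huv heq
      have h := h1 u v huv.1
      have h4 := h3 u
      have h5 := h3 v
      have h6 := huv.2
      simp only [Fin.mk.injEq] at heq
      by_cases hu : u ∈ S
      · simp only [hu, h6.1 hu, if_true] at heq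
        exact h heq
      · have hv : v ∉ S := fun hv => hu (h6.2 hv)
        simp only [hu, hv, if_false, iff_false] at heq h4 h5
        omega
    · rw [hmem']
      refine ⟨fun u v huv heq => ?_, fun v => ?_, fun v => ?_⟩
      · have hκ := κ.2 u v
        have h1 := (κ.1 u).2
        have h2 := (κ.1 v).2
        rw [Ne, Fin.ext_iff] at hκ
        by_cases hu : u ∈ S <;> by_cases hv : v ∈ S <;> simp only [hu, hv, if_true, if_false] at heq
        · exact hκ ⟨huv, by simp [hu, hv]⟩ heq
        · omega
        · omega
        · exact hκ ⟨huv, by simp [hu, hv]⟩ (by omega)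
      · have h1 := (κ.1 v).2
        split_ifs <;> omega
      · have h1 := (κ.1 v).2
        split_ifs with h <;> simp [h]
    · intro κ
      obtain ⟨h1, h2, h3⟩ := (hmem' _).1 κ.2
      ext v
      have := h3 v
      by_cases hv : v ∈ S <;> simp only [hv, if_true, if_false, iff_false] at this ⊢
      omega
    · intro κ
      ext v
      by_cases hv : v ∈ S <;> simp [hv]
  · intro κ hκ
    obtain ⟨_, h2, h3⟩ := (colorType_mem_blockExps κ N e).1 ((hmem κ).1 hκ).2
    simp only [Finset.coe_filter, Finset.mem_univ, true_and, Set.mem_ofPred_eq]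
    rw [Finset.compl_filter]
    exact ⟨h2, h3⟩

theorem card_pow_dvd_numColorings {V : Type} (H : SimpleGraph V) {k : ℕ}
    (c : V → Fin k) (hc : Function.Surjective c) (hH : ∀ u v, H.Adj u v → c u = c v)
    (A : Type) [AddCommGroup A] : Nat.card A ^ k ∣ numColorings H A := by
  choose r hr using hc
  let e : {κ : V → A // ∀ u v, H.Adj u v → κ u ≠ κ v} ≃ (Fin k → A) ×
      {κ : V → A // (∀ u v, H.Adj u v → κ u ≠ κ v) ∧ ∀ j, κ (r j) = 0} :=
    { toFun := fun κ => (fun j => κ.1 (r j), ⟨fun v => κ.1 v - κ.1 (r (c v)), fun u v huv => by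
          simpa [hH u v huv] using κ.2 u v huv, fun j => by simp [hr]⟩)
      invFun := fun p => ⟨fun v => p.2.1 v + p.1 (c v), fun u v huv => by
          simpa [hH u v huv] using p.2.2.1 u v huv⟩
      left_inv := fun κ => by ext v; simp
      right_inv := fun p => by
        ext v
        · simp [p.2.2.2, hr]
        · simp [p.2.2.2, hr] }
  rw [numColorings, Nat.card_congr e, Nat.card_prod, Nat.card_fun, Nat.card_fin]
  exact dvd_mul_right _ _

theorem pow_dvd_numColorings {V : Type} (H : SimpleGraph V) {k : ℕ}
    (c : V → Fin k) (hc : Function.Surjective c) (hH : ∀ u v, H.Adj u v → c u = c v)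
    {N : ℕ} (hN : 0 < N) : N ^ k ∣ numColorings H (Fin N) := by
  have : NeZero N := ⟨hN.ne'⟩
  have := card_pow_dvd_numColorings H c hc hH (ZMod N)
  rwa [Nat.card_zmod, numColorings_congr H (ZMod.finEquiv N).toEquiv.symm] at this

theorem pow_three_dvd_numColorings_splitGraph {V : Type} [Fintype V] [DecidableEq V]
    (G : SimpleGraph V) {S : Finset V} (hS : S.Nonempty) (hSc : Sᶜ.Nonempty)
    (h : ¬ (G.induce (S : Set V)).Connected) {N : ℕ} (hN : 0 < N) :
    N ^ 3 ∣ numColorings (splitGraph G S) (Fin N) := by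
  classical
  have : Nonempty (S : Set V) := hS.coe_sort
  rw [SimpleGraph.connected_iff, not_and_or, or_iff_left (not_not.2 this)] at h
  simp only [SimpleGraph.Preconnected, not_forall] at h
  obtain ⟨x, y, hxy⟩ := h
  obtain ⟨z, hz⟩ := hSc
  rw [Finset.mem_compl] at hz
  have hx : x.1 ∈ S := x.2
  have hy : y.1 ∈ S := y.2
  refine pow_dvd_numColorings _ (fun v => if hv : v ∈ S then
    if (G.induce (S : Set V)).Reachable x ⟨v, hv⟩ then (0 : Fin 3) else 1 else 2) ?_ ?_ hN
  · intro j
    fin_cases j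
    · exact ⟨x, by simp [hx]⟩
    · exact ⟨y, by simp [hy, hxy]⟩
    · exact ⟨z, by simp [hz]⟩
  · rintro u v ⟨huv, hS⟩
    by_cases hu : u ∈ S
    · have hv := hS.1 hu
      have hadj : (G.induce (S : Set V)).Adj ⟨u, hu⟩ ⟨v, hv⟩ := huv
      have : (G.induce (S : Set V)).Reachable x ⟨u, hu⟩ ↔
          (G.induce (S : Set V)).Reachable x ⟨v, hv⟩ :=
        ⟨fun h => h.trans hadj.reachable, fun h => h.trans hadj.symm.reachable⟩
      simp [hu, hv, this]
    · have hv : v ∉ S := fun hv => hu (hS.2 hv)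
      simp [hu, hv]

theorem splitGraph_compl {V : Type} [Fintype V] [DecidableEq V] (G : SimpleGraph V)
    (S : Finset V) : splitGraph G Sᶜ = splitGraph G S := by
  ext u v
  simp [splitGraph, not_iff_not]

theorem hasConnectedPartition_pair_of_connected {V : Type} [Fintype V] [DecidableEq V]
    (G : SimpleGraph V) {S : Finset V} (hS : (G.induce (S : Set V)).Connected)
    (hSc : (G.induce ((Sᶜ : Finset V) : Set V)).Connected) :
    HasConnectedPartition G {S.card, Sᶜ.card} := by
  have hne : S.Nonempty := by
    obtain ⟨x⟩ := hS.nonempty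
    exact ⟨x.1, x.2⟩
  have hnec : Sᶜ.Nonempty := by
    obtain ⟨x⟩ := hSc.nonempty
    exact ⟨x.1, x.2⟩
  have hdis : Disjoint S Sᶜ := disjoint_compl_right
  have hSS : S ≠ Sᶜ := hdis.ne hne.ne_empty
  refine ⟨⟨{S, Sᶜ}, ?_, ?_, ?_⟩, ?_, ?_⟩
  · rw [Finset.supIndep_pair hSS]
    exact hdis
  · simp
  · simp only [Finset.bot_eq_empty, Finset.mem_insert, Finset.mem_singleton, not_or]
    exact ⟨hne.ne_empty.symm, hnec.ne_empty.symm⟩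
  · intro p hp
    simp only [Finset.mem_insert, Finset.mem_singleton] at hp
    rcases hp with rfl | rfl
    · exact hS
    · exact hSc
  · rw [Finset.insert_val_of_notMem (by simpa using hSS)]
    simp

theorem EPositive.hasConnectedPartition_pair {V : Type} [Fintype V] [DecidableEq V]
    {G : SimpleGraph V} (hG : EPositive (csf G)) {P : Polynomial ℚ}
    (hP : ∀ N : ℕ, 0 < N → P.eval (N : ℚ) = numColorings G (Fin N)) (hP1 : P.coeff 1 ≠ 0)
    {a b : ℕ} (ha : 0 < a) (hb : 0 < b) (hab : a + b = Fintype.card V) :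
    HasConnectedPartition G {a, b} := by
  by_contra hno
  obtain ⟨c, hc, hc0, hcsf⟩ := hG
  have heval : ∀ (e : Fin 2 →₀ ℕ) (N : ℕ),
      (MvPowerSeries.coeff e (blockPoly c)).eval (N : ℚ) =
      ((∑ S ∈ Finset.univ.filter fun S : Finset V => S.card = e 0 ∧ Sᶜ.card = e 1,
        numColorings (splitGraph G S) (Fin N) : ℕ) : ℚ) := by
    intro e N
    have := coeff_blockHom_csf G N e
    rw [hcsf, blockHom_sum, MvPowerSeries.coeff_map, Polynomial.coe_evalRingHom] at this
    rw [this, Nat.cast_sum]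
    congr!
  have h2 : (MvPowerSeries.coeff (pairExp a b) (blockPoly c)).coeff 2 = 0 := by
    refine Polynomial.X_pow_dvd_iff.1 (X_pow_dvd_of_pow_dvd_eval 3 _ fun N hN => ?_) 2 (by norm_num)
    have : N ^ 3 ∣ ∑ S ∈ Finset.univ.filter fun S : Finset V =>
        S.card = pairExp a b 0 ∧ Sᶜ.card = pairExp a b 1,
        numColorings (splitGraph G S) (Fin N) := by
      refine Finset.dvd_sum fun S hS => ?_
      simp only [Finset.mem_filter, Finset.mem_univ, true_and, pairExp_zero, pairExp_one] at hS
      have hne : S.Nonempty := Finset.card_pos.1 (hS.1 ▸ ha)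
      have hnec : Sᶜ.Nonempty := Finset.card_pos.1 (hS.2 ▸ hb)
      by_cases h1 : (G.induce (S : Set V)).Connected
      · rw [← splitGraph_compl]
        refine pow_three_dvd_numColorings_splitGraph G hnec (by rwa [compl_compl]) (fun h => ?_) hN
        have := hasConnectedPartition_pair_of_connected G h1 h
        rw [hS.1, hS.2] at this
        exact hno this
      · exact pow_three_dvd_numColorings_splitGraph G hne hnec h1 hN
    obtain ⟨z, hz⟩ := this
    exact ⟨z, by rw [heval, hz]; push_cast; ring⟩
  have h1 := coeff_one_eq_zero_of_coeff_singleton hc0 (show 0 < a + b by omega)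
    (coeff_singleton_eq_zero_of_coeff_two hc ha hb h2)
  refine hP1 ?_
  have hPe : P = MvPowerSeries.coeff (pairExp (a + b) 0) (blockPoly c) := by
    refine Polynomial.eq_of_infinite_eval_eq _ _ (Set.Infinite.mono ?_
      ((Set.Ioi_infinite 0).image (Nat.cast_injective (R := ℚ)).injOn))
    rintro _ ⟨N, hN, rfl⟩
    rw [Set.mem_ofPred_eq, hP N hN, heval, Finset.sum_eq_single Finset.univ]
    · congr 2
      ext u v
      simp [splitGraph]
    · intro S hS hSu
      simp only [Finset.mem_filter, pairExp_zero, hab, Finset.card_eq_iff_eq_univ] at hS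
      exact absurd hS.2.1 hSu
    · simp [hab]
  rw [hPe, h1]

/-- The sequence `c, x 0, x 1, …` has no two equal consecutive terms. -/
def IsPathColoring {A : Type} {m : ℕ} (c : A) (x : Fin m → A) : Prop :=
  (∀ k : Fin m, (k : ℕ) = 0 → c ≠ x k) ∧ ∀ j k : Fin m, (k : ℕ) = (j : ℕ) + 1 → x j ≠ x k

theorem isPathColoring_cons {A : Type} {m : ℕ} (c y : A) (x : Fin m → A) :
    IsPathColoring c (Fin.cons y x : Fin (m + 1) → A) ↔ c ≠ y ∧ IsPathColoring y x := by
  simp [IsPathColoring, Fin.forall_fin_succ, eq_comm]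

/-- The number of sequences `x` of length `m` such that `c, x 0, x 1, …` has no two equal
consecutive terms and its last term satisfies `Q`. -/
noncomputable def pathCount {A : Type} (Q : A → Prop) (m : ℕ) (c : A) : ℕ :=
  Nat.card {x : Fin m → A // IsPathColoring c x ∧ Q ((Fin.cons c x : Fin (m + 1) → A) (Fin.last m))}

theorem pathCount_zero {A : Type} (Q : A → Prop) [DecidablePred Q] (c : A) :
    pathCount Q 0 c = if Q c then 1 else 0 := by
  rw [pathCount, Nat.card_congr (Equiv.subtypeEquivRight (q := fun _ => Q c) fun x => by
    simp [IsPathColoring])]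
  split_ifs with h <;> simp [h]

theorem pathCount_succ {A : Type} [Fintype A] [DecidableEq A] (Q : A → Prop) (m : ℕ) (c : A) :
    pathCount Q (m + 1) c = ∑ y ∈ Finset.univ.erase c, pathCount Q m y := by
  have e : {x : Fin (m + 1) → A // IsPathColoring c x ∧
        Q ((Fin.cons c x : Fin (m + 2) → A) (Fin.last (m + 1)))} ≃
      Σ y : {y : A // y ∈ Finset.univ.erase c}, {x : Fin m → A // IsPathColoring y.1 x ∧
        Q ((Fin.cons y.1 x : Fin (m + 1) → A) (Fin.last m))} :=
    { toFun := fun x => by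
        have h : IsPathColoring c (Fin.cons (x.1 0) (Fin.tail x.1) : Fin (m + 1) → A) := by
          rw [Fin.cons_self_tail]; exact x.2.1
        rw [isPathColoring_cons] at h
        refine ⟨⟨x.1 0, by simpa [eq_comm] using h.1⟩, ⟨Fin.tail x.1, h.2, ?_⟩⟩
        rw [Fin.cons_self_tail]
        exact x.2.2
      invFun := fun p => ⟨Fin.cons p.1.1 p.2.1, (isPathColoring_cons _ _ _).2
        ⟨(Finset.ne_of_mem_erase p.1.2).symm, p.2.2.1⟩, p.2.2.2⟩
      left_inv := fun x => by
        ext1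
        exact Fin.cons_self_tail x.1
      right_inv := fun p => by
        obtain ⟨y, x⟩ := p
        rfl }
  rw [pathCount, Nat.card_congr e, Nat.card_sigma, Finset.univ_eq_attach,
    ← Finset.sum_attach (Finset.univ.erase c)]
  rfl

theorem pathCount_true {A : Type} [Fintype A] (m : ℕ) (c : A) :
    pathCount (fun _ => True) m c = (Fintype.card A - 1) ^ m := by
  classical
  induction m generalizing c with
  | zero => simp [pathCount_zero]
  | succ m ih => simp [pathCount_succ, ih, pow_succ, mul_comm]

/-- Polynomials in the number of colours counting the paths on `m + 1` vertices with prescribed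
first colour and last colour different from a given one, which is equal (first component) or
not equal (second component) to the first colour. -/
noncomputable def closingPoly : ℕ → Polynomial ℚ × Polynomial ℚ
  | 0 => (0, 1)
  | m + 1 => ((Polynomial.X - 1) * (closingPoly m).2,
      (closingPoly m).1 + (Polynomial.X - 2) * (closingPoly m).2)

theorem eval_zero_closingPoly (m : ℕ) : (closingPoly m).1.eval 0 = (-1) ^ m * m ∧
    (closingPoly m).2.eval 0 = (-1) ^ m * (m + 1) := by
  induction m with
  | zero => simp [closingPoly]
  | succ m ih =>
    have h2 : (2 : Polynomial ℚ).eval 0 = 2 := Polynomial.eval_ofNat 2 0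
    simp only [closingPoly, Polynomial.eval_mul, Polynomial.eval_add, Polynomial.eval_sub,
      Polynomial.eval_X, Polynomial.eval_one, h2, ih.1, ih.2]
    push_cast
    constructor <;> ring

theorem pathCount_ne {A : Type} [Fintype A] (c : A) (m : ℕ) :
    ((pathCount (· ≠ c) m c : ℕ) : ℚ) = (closingPoly m).1.eval (Fintype.card A : ℚ) ∧
    ∀ y, y ≠ c → ((pathCount (· ≠ c) m y : ℕ) : ℚ) =
      (closingPoly m).2.eval (Fintype.card A : ℚ) := by
  classical
  induction m with
  | zero => simp +contextual [closingPoly, pathCount_zero]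
  | succ m ih =>
    have hA : 1 ≤ Fintype.card A := Fintype.card_pos_iff.2 ⟨c⟩
    constructor
    · rw [pathCount_succ, Nat.cast_sum, Finset.sum_congr rfl fun y hy =>
        ih.2 y (Finset.ne_of_mem_erase hy), Finset.sum_const, Finset.card_erase_of_mem
        (Finset.mem_univ c), Finset.card_univ]
      simp [closingPoly, Nat.cast_sub hA]
    · intro y hy
      have hc : c ∈ Finset.univ.erase y := by simp [hy.symm]
      have hA2 : 2 ≤ Fintype.card A := Fintype.one_lt_card_iff.2 ⟨y, c, hy⟩
      rw [pathCount_succ, Nat.cast_sum, ← Finset.add_sum_erase _ _ hc, ih.1,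
        Finset.sum_congr rfl fun z hz => ih.2 z (Finset.ne_of_mem_erase hz), Finset.sum_const,
        Finset.card_erase_of_mem hc, Finset.card_erase_of_mem (Finset.mem_univ y),
        Finset.card_univ, Nat.sub_sub]
      simp [closingPoly, Nat.cast_sub hA2]

theorem proper_fromRel_iff {V A : Type} (r : V → V → Prop) (κ : V → A) :
    (∀ u v, (SimpleGraph.fromRel r).Adj u v → κ u ≠ κ v) ↔
      ∀ u v, u ≠ v → r u v → κ u ≠ κ v := by
  simp only [SimpleGraph.fromRel_adj]
  constructor
  · exact fun h u v huv hr => h u v ⟨huv, Or.inl hr⟩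
  · rintro h u v ⟨huv, hr | hr⟩
    · exact h u v huv hr
    · exact (h v u huv.symm hr).symm

theorem proper_sun_iff {A : Type} (n : ℕ) (lam : Fin n → ℕ) (body : Fin n → Fin n → Prop)
    (κ : (Fin n ⊕ ((i : Fin n) × Fin (lam i))) → A) :
    (∀ u v, (SimpleGraph.fromRel (sunRel n lam body)).Adj u v → κ u ≠ κ v) ↔
      (∀ i j, (SimpleGraph.fromRel body).Adj i j → κ (Sum.inl i) ≠ κ (Sum.inl j)) ∧
      ∀ i, IsPathColoring (κ (Sum.inl i)) fun k => κ (Sum.inr ⟨i, k⟩) := by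
  have hb := proper_fromRel_iff body fun i => κ (Sum.inl i)
  rw [proper_fromRel_iff, hb]
  constructor
  · intro h
    refine ⟨fun i j hij hr => h _ _ (by simpa using hij) hr, fun i => ⟨fun k hk => ?_, ?_⟩⟩
    · exact h (Sum.inl i) (Sum.inr ⟨i, k⟩) (by simp) ⟨rfl, hk⟩
    · intro j k hjk
      refine h (Sum.inr ⟨i, j⟩) (Sum.inr ⟨i, k⟩) ?_ ⟨rfl, hjk⟩
      intro heq
      simp only [Sum.inr.injEq, Sigma.mk.injEq, heq_eq_eq, true_and] at heq
      subst heq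
      omega
  · rintro ⟨h1, h2⟩ (i | ⟨i, k⟩) (j | ⟨j, l⟩) hne hr
    · exact h1 i j (by simpa using hne) hr
    · obtain ⟨rfl, hr⟩ := hr
      exact (h2 _).1 l hr
    · exact hr.elim
    · obtain ⟨hij, hr⟩ := hr
      obtain rfl : i = j := hij
      exact (h2 i).2 k l hr

theorem numColorings_sun (n : ℕ) (lam : Fin n → ℕ) (body : Fin n → Fin n → Prop) (A : Type)
    [Fintype A] : numColorings (SimpleGraph.fromRel (sunRel n lam body)) A =
      numColorings (SimpleGraph.fromRel body) A * (Fintype.card A - 1) ^ ∑ i, lam i := by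
  classical
  let e : {κ : (Fin n ⊕ ((i : Fin n) × Fin (lam i))) → A //
        ∀ u v, (SimpleGraph.fromRel (sunRel n lam body)).Adj u v → κ u ≠ κ v} ≃
      Σ κ : {κ : Fin n → A // ∀ u v, (SimpleGraph.fromRel body).Adj u v → κ u ≠ κ v},
        ∀ i, {x : Fin (lam i) → A // IsPathColoring (κ.1 i) x ∧ True} :=
    { toFun := fun κ => ⟨⟨fun i => κ.1 (Sum.inl i), ((proper_sun_iff n lam body κ.1).1 κ.2).1⟩,
        fun i => ⟨fun k => κ.1 (Sum.inr ⟨i, k⟩),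
          ((proper_sun_iff n lam body κ.1).1 κ.2).2 i, trivial⟩⟩
      invFun := fun p => ⟨Sum.elim p.1.1 fun q => (p.2 q.1).1 q.2,
        (proper_sun_iff n lam body _).2 ⟨p.1.2, fun i => (p.2 i).2.1⟩⟩
      left_inv := fun κ => by
        ext (i | ⟨i, k⟩) <;> rfl
      right_inv := fun p => rfl }
  have h : ∀ κ : Fin n → A, Nat.card (∀ i, {x : Fin (lam i) → A // IsPathColoring (κ i) x ∧ True}) =
      (Fintype.card A - 1) ^ ∑ i, lam i := by
    intro κ
    rw [Nat.card_pi, ← Finset.prod_pow_eq_pow_sum]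
    exact Finset.prod_congr rfl fun i _ => pathCount_true (lam i) (κ i)
  rw [numColorings, Nat.card_congr e, Nat.card_sigma, Finset.sum_congr rfl fun κ _ => h κ.1,
    Finset.sum_const, Finset.card_univ, smul_eq_mul, numColorings, Nat.card_eq_fintype_card]

theorem proper_cycle_iff {A : Type} {m : ℕ} (hm : 0 < m) (c : A) (x : Fin m → A) :
    (∀ u v, (SimpleGraph.fromRel fun i i' : Fin (m + 1) =>
        (i' : ℕ) = ((i : ℕ) + 1) % (m + 1)).Adj u v →
        (Fin.cons c x : Fin (m + 1) → A) u ≠ (Fin.cons c x : Fin (m + 1) → A) v) ↔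
      IsPathColoring c x ∧ (Fin.cons c x : Fin (m + 1) → A) (Fin.last m) ≠ c := by
  rw [proper_fromRel_iff]
  constructor
  · intro h
    refine ⟨⟨fun k hk => ?_, fun j k hjk => ?_⟩, ?_⟩
    · refine h 0 k.succ (Fin.succ_ne_zero k).symm ?_
      rw [Nat.mod_eq_of_lt (by simpa using hm)]
      simp [hk]
    · refine h j.succ k.succ ?_ ?_
      · rw [Ne, Fin.ext_iff]
        simp only [Fin.val_succ]
        omega
      · have := k.2
        rw [Fin.val_succ, Fin.val_succ, Nat.mod_eq_of_lt (by omega), hjk]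
    · refine h (Fin.last m) 0 ?_ ?_
      · rw [Ne, Fin.ext_iff]
        simp only [Fin.val_last, Fin.val_zero]
        omega
      · simp
  · rintro ⟨⟨h1, h2⟩, h3⟩ u v hne hr
    rcases eq_or_ne u (Fin.last m) with rfl | hu
    · obtain rfl : v = 0 := by
        ext
        simpa using hr
      exact h3
    · have hu' : (u : ℕ) < m := Fin.val_lt_last hu
      rw [Nat.mod_eq_of_lt (by omega)] at hr
      refine Fin.cases (fun hne hr => ?_) (fun l hne hr => ?_) v hne hr
      · simp at hr
      · refine Fin.cases (fun _ hr _ => ?_) (fun k _ hr _ => ?_) u hne hr hu'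
        · exact h1 l (by simpa using hr)
        · exact h2 k l (by simpa using hr)

theorem numColorings_cycle {m : ℕ} (hm : 0 < m) (A : Type) [Fintype A] :
    (numColorings (SimpleGraph.fromRel fun i i' : Fin (m + 1) =>
      (i' : ℕ) = ((i : ℕ) + 1) % (m + 1)) A : ℚ) =
      Fintype.card A * (closingPoly m).1.eval (Fintype.card A : ℚ) := by
  classical
  let e : {κ : Fin (m + 1) → A // ∀ u v, (SimpleGraph.fromRel fun i i' : Fin (m + 1) =>
      (i' : ℕ) = ((i : ℕ) + 1) % (m + 1)).Adj u v → κ u ≠ κ v} ≃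
      Σ c : A, {x : Fin m → A // IsPathColoring c x ∧
        (Fin.cons c x : Fin (m + 1) → A) (Fin.last m) ≠ c} :=
    { toFun := fun κ => ⟨κ.1 0, ⟨Fin.tail κ.1, (proper_cycle_iff hm _ _).1 (by
        rw [Fin.cons_self_tail]; exact κ.2)⟩⟩
      invFun := fun p => ⟨Fin.cons p.1 p.2.1, (proper_cycle_iff hm _ _).2 p.2.2⟩
      left_inv := fun κ => by
        ext1
        exact Fin.cons_self_tail κ.1
      right_inv := fun p => rfl }
  have h (c : A) : (Nat.card {x : Fin m → A // IsPathColoring c x ∧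
      (Fin.cons c x : Fin (m + 1) → A) (Fin.last m) ≠ c} : ℚ) =
      (closingPoly m).1.eval (Fintype.card A : ℚ) := (pathCount_ne c m).1
  rw [numColorings, Nat.card_congr e, Nat.card_sigma, Nat.cast_sum,
    Finset.sum_congr rfl fun c _ => h c, Finset.sum_const, Finset.card_univ,
    nsmul_eq_mul]

theorem numColorings_complete (n : ℕ) (A : Type) [Fintype A] :
    (numColorings (SimpleGraph.fromRel fun i i' : Fin n => i ≠ i') A : ℚ) =
      (descPochhammer ℚ n).eval (Fintype.card A : ℚ) := by
  classical
  have e : {κ : Fin n → A // ∀ u v, (SimpleGraph.fromRel fun i i' : Fin n => i ≠ i').Adj u v →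
      κ u ≠ κ v} ≃ (Fin n ↪ A) :=
    (Equiv.subtypeEquivRight fun κ => by
      rw [proper_fromRel_iff]
      simp only [Function.Injective]
      exact ⟨fun h u v huv => by_contra fun hne => h u v hne hne huv,
        fun h u v hne _ huv => hne (h huv)⟩).trans
      (Equiv.subtypeInjectiveEquivEmbedding (Fin n) A)
  rw [numColorings, Nat.card_congr e, Nat.card_eq_fintype_card, Fintype.card_embedding_eq,
    Fintype.card_fin, descPochhammer_eval_eq_descFactorial]

theorem EPositive.sun_hasConnectedPartition_pair {n : ℕ} {lam : Fin n → ℕ}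
    {body : Fin n → Fin n → Prop}
    (h : EPositive (csf (SimpleGraph.fromRel (sunRel n lam body)))) {q : Polynomial ℚ}
    (hq : ∀ N : ℕ, (numColorings (SimpleGraph.fromRel body) (Fin N) : ℚ) =
      (Polynomial.X * q).eval (N : ℚ)) (hq0 : q.coeff 0 ≠ 0) {a b : ℕ} (ha : 0 < a) (hb : 0 < b)
    (hab : a + b = (∑ i, lam i) + n) :
    HasConnectedPartition (SimpleGraph.fromRel (sunRel n lam body)) {a, b} := by
  refine h.hasConnectedPartition_pair
    (P := Polynomial.X * (q * (Polynomial.X - 1) ^ ∑ i, lam i)) ?_ ?_ ha hb ?_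
  · intro N hN
    rw [numColorings_sun, Nat.cast_mul, hq, Fintype.card_fin, Nat.cast_pow, Nat.cast_sub hN]
    simp [mul_assoc]
  · rw [Polynomial.coeff_X_mul, Polynomial.mul_coeff_zero]
    refine mul_ne_zero hq0 ?_
    rw [Polynomial.coeff_zero_eq_eval_zero]
    simp
  · simp [hab, add_comm]

theorem subset_ray_of_connected {n : ℕ} {lam : Fin n → ℕ} {body : Fin n → Fin n → Prop}
    {p : Finset (Fin n ⊕ ((i : Fin n) × Fin (lam i)))}
    (hp : ((SimpleGraph.fromRel (sunRel n lam body)).induce (p : Set _)).Connected)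
    {i : Fin n} {k : Fin (lam i)} (hk : Sum.inr ⟨i, k⟩ ∈ p) (hi : Sum.inl i ∉ p) :
    p ⊆ Finset.univ.image fun k : Fin (lam i) => Sum.inr ⟨i, k⟩ := by
  intro y hy
  obtain ⟨w⟩ := hp.preconnected ⟨_, hk⟩ ⟨y, hy⟩
  have key : ∀ (u v : (p : Set (Fin n ⊕ ((i : Fin n) × Fin (lam i))))),
      ((SimpleGraph.fromRel (sunRel n lam body)).induce (p : Set _)).Walk u v →
      (∃ l : Fin (lam i), u.1 = Sum.inr ⟨i, l⟩) → ∃ l : Fin (lam i), v.1 = Sum.inr ⟨i, l⟩ := by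
    intro u v w
    induction w with
    | nil => exact id
    | @cons u v _ h _ ih =>
      rintro ⟨l, hl⟩
      apply ih
      obtain ⟨u, hu⟩ := u
      obtain ⟨v, hv⟩ := v
      simp only at hl
      subst hl
      have hadj : (SimpleGraph.fromRel (sunRel n lam body)).Adj (Sum.inr ⟨i, l⟩) v := h
      rw [SimpleGraph.fromRel_adj] at hadj
      rcases v with j | ⟨j, k'⟩
      · rcases hadj.2 with h' | h'
        · exact h'.elim
        · obtain rfl : i = j := h'.1
          exact absurd hv hi
      · have hij : i = j := by
          rcases hadj.2 with h' | h'
          · exact h'.1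
          · exact h'.1.symm
        subst hij
        exact ⟨k', rfl⟩
  obtain ⟨l, hl⟩ := key _ _ w ⟨k, rfl⟩
  exact Finset.mem_image.2 ⟨l, Finset.mem_univ _, hl.symm⟩

/-- If all blocks of a connected partition of a sun-like graph are larger than the rays, then
every block is a union of rays together with their attachment vertices. -/
theorem dvd_card_of_mem_parts {n : ℕ} {lam : Fin n → ℕ} {body : Fin n → Fin n → Prop}
    (P : Finpartition (Finset.univ : Finset (Fin n ⊕ ((i : Fin n) × Fin (lam i)))))
    (hP : ∀ p ∈ P.parts, ((SimpleGraph.fromRel (sunRel n lam body)).induce (p : Set _)).Connected)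
    (hcard : ∀ p ∈ P.parts, ∀ i, lam i < p.card) {g : ℕ} (hg : ∀ i, g ∣ lam i + 1)
    {p : Finset (Fin n ⊕ ((i : Fin n) × Fin (lam i)))} (hp : p ∈ P.parts) : g ∣ p.card := by
  have hbase : ∀ q ∈ P.parts, ∀ i (k : Fin (lam i)), Sum.inr ⟨i, k⟩ ∈ q → Sum.inl i ∈ q := by
    intro q hq i k hk
    by_contra hi
    have h1 := Finset.card_le_card (subset_ray_of_connected (hP q hq) hk hi)
    have h2 := h1.trans Finset.card_image_le
    rw [Finset.card_univ, Fintype.card_fin] at h2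
    exact absurd (hcard q hq i) (by omega)
  have hpe : p = (Finset.univ.filter fun i => Sum.inl i ∈ p).disjSum
      ((Finset.univ.filter fun i => Sum.inl i ∈ p).sigma fun i => (Finset.univ : Finset (Fin (lam i)))) := by
    ext (i | ⟨i, k⟩)
    · simp
    · simp only [Finset.inr_mem_disjSum, Finset.mem_sigma, Finset.mem_filter, Finset.mem_univ,
        true_and, and_true]
      refine ⟨hbase p hp i k, fun hi => ?_⟩
      obtain ⟨q, hq, hkq⟩ := P.exists_mem (Finset.mem_univ (Sum.inr ⟨i, k⟩))
      rwa [P.eq_of_mem_parts hp hq hi (hbase q hq i k hkq)]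
  rw [hpe, Finset.card_disjSum, Finset.card_sigma, Finset.card_eq_sum_ones,
    ← Finset.sum_add_distrib]
  refine Finset.dvd_sum fun i _ => ?_
  rw [Finset.card_univ, Fintype.card_fin, add_comm]
  exact hg i

theorem not_hasConnectedPartition_sun {n : ℕ} {lam : Fin n → ℕ} {body : Fin n → Fin n → Prop}
    {i₁ : Fin n} (hmax : ∀ i, lam i ≤ lam i₁) {a : ℕ} (ha : lam i₁ + 2 ≤ a)
    (hgcd : 1 < Finset.univ.gcd (fun i => lam i + 1)) :
    ¬ HasConnectedPartition (SimpleGraph.fromRel (sunRel n lam body)) {a, lam i₁ + 2} := by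
  rintro ⟨P, hP, hcard⟩
  have hg : ∀ i, Finset.univ.gcd (fun i => lam i + 1) ∣ lam i + 1 := fun i =>
    Finset.gcd_dvd (Finset.mem_univ i)
  have hlarge : ∀ p ∈ P.parts, ∀ i, lam i < p.card := by
    intro p hp i
    have hmem : p.card ∈ P.parts.val.map Finset.card := Multiset.mem_map_of_mem _ hp
    rw [hcard] at hmem
    have := hmax i
    simp only [Multiset.insert_eq_cons, Multiset.mem_cons, Multiset.mem_singleton] at hmem
    omega
  obtain ⟨p, hp, hpc⟩ : ∃ p ∈ P.parts.val, Finset.card p = lam i₁ + 2 := by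
    rw [← Multiset.mem_map, hcard]
    simp
  have h1 := dvd_card_of_mem_parts P hP hlarge hg hp
  rw [hpc] at h1
  have h2 := (Nat.dvd_add_right (hg i₁)).1 (show _ ∣ lam i₁ + 1 + 1 from h1)
  exact absurd (Nat.dvd_one.1 h2) hgcd.ne'

/-- If `λ_{i₁} = max λ_i`, `λ_{i₁} + 2 ≤ (Σ_{i ≠ i₁} λ_i) + n - 2` and
`gcd(λ_1+1, …, λ_n+1) = m > 1`, then neither `S(n; λ)` nor `S̄(n; λ)` has a connected
partition of type `((Σ_{i ≠ i₁} λ_i) + n - 2, λ_{i₁} + 2)`, hence neither is `e`-positive. -/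
theorem sun_gcd_not_ePositive (n : ℕ) (hn : 3 ≤ n) (lam : Fin n → ℕ)
    (hpos : ∀ i, 0 < lam i) (i₁ : Fin n) (hmax : ∀ i, lam i ≤ lam i₁)
    (hineq : lam i₁ + 2 ≤ (∑ i ∈ Finset.univ.erase i₁, lam i) + n - 2)
    (hgcd : 1 < Finset.univ.gcd (fun i => lam i + 1)) :
    ¬ HasConnectedPartition (sunGraph n lam)
        {(∑ i ∈ Finset.univ.erase i₁, lam i) + n - 2, lam i₁ + 2} ∧
    ¬ HasConnectedPartition (completeSunGraph n lam)
        {(∑ i ∈ Finset.univ.erase i₁, lam i) + n - 2, lam i₁ + 2} ∧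
    ¬ EPositive (csf (sunGraph n lam)) ∧
    ¬ EPositive (csf (completeSunGraph n lam)) := by
  have hsum := Finset.add_sum_erase Finset.univ lam (Finset.mem_univ i₁)
  refine ⟨not_hasConnectedPartition_sun hmax hineq hgcd,
    not_hasConnectedPartition_sun hmax hineq hgcd, fun h => ?_, fun h => ?_⟩
  · refine not_hasConnectedPartition_sun hmax hineq hgcd
      (EPositive.sun_hasConnectedPartition_pair h (q := (closingPoly (n - 1)).1) (fun N => ?_) ?_
        (by omega) (by omega) (by omega))
    · obtain ⟨m, rfl⟩ : ∃ m, n = m + 1 := ⟨n - 1, by omega⟩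
      rw [numColorings_cycle (by omega)]
      simp
    · rw [Polynomial.coeff_zero_eq_eval_zero, (eval_zero_closingPoly _).1]
      have : ((n - 1 : ℕ) : ℚ) ≠ 0 := Nat.cast_ne_zero.2 (by omega)
      simpa using this
  · have h0 : (descPochhammer ℚ n).coeff 0 = 0 := by
      rw [Polynomial.coeff_zero_eq_eval_zero, descPochhammer_ne_zero_eval_zero _ (by omega)]
    obtain ⟨q, hq⟩ := Polynomial.X_dvd_iff.2 h0
    refine not_hasConnectedPartition_sun hmax hineq hgcd
      (EPositive.sun_hasConnectedPartition_pair h (q := q) (fun N => ?_) ?_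
        (by omega) (by omega) (by omega))
    · rw [numColorings_complete, Fintype.card_fin, hq]
    · have := coeff_one_descPochhammer_ne_zero (show 0 < n by omega)
      rwa [hq, Polynomial.coeff_X_mul] at this
end
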